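/- arXiv:1201.2015 — 3 statements merged into one kernel-verified Lean document; each statement's English description precedes it below -/
import Mathlib

section
/- For real A, B > 0 and c ∈ [−2, 2], the function φ(z) = A·Log((1+z)/(1−z)) + B·z/(1 + cz + z²) is holomorphic and injective on 𝔻, and its image φ(𝔻) is convex in the horizontal direction. -/
open Complex Set
open scoped Real

noncomputable section

/-- The open unit disk in the complex plane. -/
def unitDisk : Set ℂ := Metric.ball 0 1

/-- A set is convex in the horizontal direction (CHD) if its intersection with
every horizontal line is connected (possibly empty). -/
def IsCHD (Ω : Set ℂ) : Prop := ∀ t : ℝ, IsPreconnected {z | z ∈ Ω ∧ z.im = t}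

/-- Integral of `f` along the line segment from `0` to `z`. -/
def segInt (f : ℂ → ℂ) (z : ℂ) : ℂ := ∫ t in (0:ℝ)..1, z * f ((t : ℂ) * z)

/-- Pochhammer symbol `(a)_m = a (a+1) ⋯ (a+m-1)`. -/
def poch (a : ℂ) (m : ℕ) : ℂ := ∏ i ∈ Finset.range m, (a + i)

/-- Appell's first hypergeometric function `F₁(a, b₁, b₂; c; x, y)`. -/
def appellF1 (a b₁ b₂ c x y : ℂ) : ℂ :=
  ∑' (k : ℕ) (l : ℕ),
    poch a (k + l) * poch b₁ k * poch b₂ l /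
      (poch c (k + l) * (Nat.factorial k : ℂ) * (Nat.factorial l : ℂ)) * x ^ k * y ^ l

/-- The horizontal strip `|Im w| < π / 2`. -/
def halfPiStrip : Set ℂ := {w | w.im ∈ Set.Ioo (-(π / 2)) (π / 2)}

/-- A map of the strip `|Im w| < π / 2` that is continuous, injective, and such that the level sets
of its imaginary part are connected. -/
structure IsHorizontalStripMap (F : ℂ → ℂ) : Prop where
  continuousOn : ContinuousOn F halfPiStrip
  injOn : Set.InjOn F halfPiStrip
  level : ∀ t : ℝ, IsPreconnected {w | w ∈ halfPiStrip ∧ (F w).im = t}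

namespace IsHorizontalStripMap

theorem add_real {F : ℂ → ℂ} (hF : IsHorizontalStripMap F) (κ : ℝ) :
    IsHorizontalStripMap (fun w => F w + (κ : ℂ)) where
  continuousOn := hF.continuousOn.add continuousOn_const
  injOn := fun _ ha _ hb h => hF.injOn ha hb (add_right_cancel h)
  level := fun t => by simpa using hF.level t

theorem comp_add_real {F : ℂ → ℂ} (hF : IsHorizontalStripMap F) (δ : ℝ) :
    IsHorizontalStripMap (fun w => F (w + (δ : ℂ))) where
  continuousOn := hF.continuousOn.comp (by fun_prop) (fun w hw => by
    simpa [halfPiStrip] using hw)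
  injOn := fun a ha b hb h => add_right_cancel
    (hF.injOn (by simpa [halfPiStrip] using ha) (by simpa [halfPiStrip] using hb) h)
  level := fun t => by
    convert (hF.level t).image (fun w => w - (δ : ℂ)) (by fun_prop) using 1
    ext w
    constructor
    · rintro ⟨hw, h⟩
      exact ⟨w + δ, ⟨by simpa [halfPiStrip] using hw, h⟩, by simp⟩
    · rintro ⟨v, ⟨hv, h⟩, rfl⟩
      exact ⟨by simpa [halfPiStrip] using hv, by simpa using h⟩

theorem neg_comp_neg {F : ℂ → ℂ} (hF : IsHorizontalStripMap F) :
    IsHorizontalStripMap (fun w => -F (-w)) := by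
  have hneg : ∀ w ∈ halfPiStrip, -w ∈ halfPiStrip := fun w hw => by
    simp only [halfPiStrip, Set.mem_ofPred_eq, Set.mem_Ioo, Complex.neg_im] at hw ⊢
    constructor <;> linarith [hw.1, hw.2]
  refine ⟨(hF.continuousOn.comp (by fun_prop) hneg).neg, fun a ha b hb h => ?_, fun t => ?_⟩
  · exact neg_injective (hF.injOn (hneg a ha) (hneg b hb) (neg_injective h))
  · convert (hF.level (-t)).image (fun w => -w) (by fun_prop) using 1
    ext w
    constructor
    · rintro ⟨hw, h⟩
      exact ⟨-w, ⟨hneg w hw, by simp at h; linarith⟩, by simp⟩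
    · rintro ⟨v, ⟨hv, h⟩, rfl⟩
      exact ⟨hneg v hv, by simp [h]⟩

theorem isCHD_image {F : ℂ → ℂ} (hF : IsHorizontalStripMap F) : IsCHD (F '' halfPiStrip) := by
  intro t
  convert (hF.level t).image F (hF.continuousOn.mono fun w hw => hw.1) using 1
  ext z
  constructor
  · rintro ⟨⟨w, hw, rfl⟩, h⟩
    exact ⟨w, ⟨hw, h⟩, rfl⟩
  · rintro ⟨w, ⟨hw, h⟩, rfl⟩
    exact ⟨⟨w, hw, rfl⟩, h⟩

end IsHorizontalStripMap

/-- Rolle's theorem for a component of a holomorphic function along a segment. -/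
theorem exists_re_mul_deriv_eq_zero {F F' : ℂ → ℂ} {a b : ℂ} (hab : a ≠ b) (hF : F a = F b)
    (hd : ∀ τ ∈ Set.Icc (0 : ℝ) 1, HasDerivAt F (F' (a + τ * (b - a))) (a + τ * (b - a)))
    (ζ : ℂ) : ∃ τ ∈ Set.Ioo (0 : ℝ) 1, (ζ * F' (a + τ * (b - a))).re = 0 := by
  have hba : b - a ≠ 0 := sub_ne_zero.mpr hab.symm
  have key : ∀ τ ∈ Set.Icc (0 : ℝ) 1,
      HasDerivAt (fun τ : ℝ => (ζ / (b - a) * F (a + τ * (b - a))).re)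
        (ζ * F' (a + τ * (b - a))).re τ := by
    intro τ hτ
    have h1 : HasDerivAt (fun s : ℂ => a + s * (b - a)) (b - a) (τ : ℂ) := by
      simpa using ((hasDerivAt_id (τ : ℂ)).mul_const (b - a)).const_add a
    have h2 := ((hd τ hτ).comp (τ : ℂ) h1).const_mul (ζ / (b - a))
    have h3 := h2.real_of_complex
    refine h3.congr_deriv (congrArg Complex.re ?_)
    field_simp
  obtain ⟨τ, hτ, h⟩ := exists_hasDerivAt_eq_zero (zero_lt_one' ℝ)
    (fun τ hτ => (key τ hτ).continuousAt.continuousWithinAt) (by simp [hF])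
    (fun τ hτ => key τ (Set.Ioo_subset_Icc_self hτ))
  exact ⟨τ, hτ, h⟩

theorem segment_mem_halfPiStrip {a b : ℂ} (ha : a ∈ halfPiStrip) (hb : b ∈ halfPiStrip) {τ : ℝ}
    (hτ : τ ∈ Set.Icc (0 : ℝ) 1) : a + τ * (b - a) ∈ halfPiStrip := by
  simp only [halfPiStrip, Set.mem_ofPred_eq] at ha hb ⊢
  have := (convex_Ioo (-(π / 2)) (π / 2)).add_smul_sub_mem ha hb hτ
  simpa using this

theorem add_mul_sub_mul_pos {x y τ : ℝ} (hxy : 0 < x * y) (hτ : τ ∈ Set.Ioo (0 : ℝ) 1) :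
    x + τ * (y - x) ≠ 0 := by
  intro h
  have h1 : x * (1 - τ) = -(τ * y) := by linarith
  have h2 : x * x * (1 - τ) = -(τ * (x * y)) := by linear_combination x * h1
  have := mul_pos hτ.1 hxy
  have := mul_nonneg (mul_self_nonneg x) (sub_nonneg.mpr hτ.2.le)
  linarith

/-- The level sets of the imaginary part of a map commuting with conjugation are connected as soon
as those at positive heights are, and the level at height zero is the real axis. -/
theorem isPreconnected_level_of_conj {F : ℂ → ℂ}
    (hconj : ∀ w, F ((starRingEnd ℂ) w) = (starRingEnd ℂ) (F w))
    (hzero : ∀ w ∈ halfPiStrip, (F w).im = 0 → w.im = 0)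
    (hpos : ∀ t > 0, IsPreconnected {w | w ∈ halfPiStrip ∧ (F w).im = t}) (t : ℝ) :
    IsPreconnected {w | w ∈ halfPiStrip ∧ (F w).im = t} := by
  have hmem : ∀ w ∈ halfPiStrip, (starRingEnd ℂ) w ∈ halfPiStrip := fun w hw => by
    simp only [halfPiStrip, Set.mem_ofPred_eq, Set.mem_Ioo, Complex.conj_im] at hw ⊢
    constructor <;> linarith [hw.1, hw.2]
  rcases lt_trichotomy t 0 with ht | rfl | ht
  · convert (hpos (-t) (by linarith)).image (starRingEnd ℂ) Complex.continuous_conj.continuousOn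
      using 1
    ext w
    constructor
    · rintro ⟨hw, h⟩
      exact ⟨(starRingEnd ℂ) w, ⟨hmem w hw, by rw [hconj, Complex.conj_im, h]⟩, by simp⟩
    · rintro ⟨v, ⟨hv, h⟩, rfl⟩
      exact ⟨hmem v hv, by rw [hconj, Complex.conj_im, h, neg_neg]⟩
  · convert isPreconnected_range Complex.continuous_ofReal using 1
    ext w
    constructor
    · rintro ⟨hw, h⟩
      exact ⟨w.re, Complex.ext rfl (by simp [hzero w hw h])⟩
    · rintro ⟨x, rfl⟩
      refine ⟨by simp [halfPiStrip, Real.pi_pos], ?_⟩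
      rw [← Complex.conj_eq_iff_im, ← hconj, Complex.conj_ofReal]
  · exact hpos t ht

/-- If `g` has the sign of `x` and `h = g` has the sign of `y`, then `x` and `y` have equal signs. -/
theorem both_zero_or_mul_pos {x y g h : ℝ} (hgh : g = h) (hx0 : x = 0 → g = 0)
    (hx : x ≠ 0 → 0 < x * g) (hy0 : y = 0 → h = 0) (hy : y ≠ 0 → 0 < y * h) :
    (x = 0 ∧ y = 0) ∨ 0 < x * y := by
  subst hgh
  by_cases hg : g = 0
  · refine Or.inl ⟨not_not.mp fun h => ?_, not_not.mp fun h => ?_⟩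
    · simpa [hg] using hx h
    · simpa [hg] using hy h
  · have h1 := mul_pos (hx (mt hx0 hg)) (hy (mt hy0 hg))
    have h2 : 0 < (x * y) * (g * g) := by linarith
    exact Or.inr (pos_of_mul_pos_left h2 (mul_self_nonneg g))

theorem mul_sin_pos {v : ℝ} (hv : v ∈ Set.Ioo (-(π / 2)) (π / 2)) (h0 : v ≠ 0) :
    0 < v * Real.sin v := by
  rcases lt_or_gt_of_ne h0 with h | h
  · exact mul_pos_of_neg_of_neg h
      (Real.sin_neg_of_neg_of_neg_pi_lt h (by linarith [hv.1, Real.pi_pos]))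
  · exact mul_pos h (Real.sin_pos_of_pos_of_lt_pi h (by linarith [hv.2, Real.pi_pos]))

theorem mul_sinh_pos {u : ℝ} (h0 : u ≠ 0) : 0 < u * Real.sinh u := by
  rcases lt_or_gt_of_ne h0 with h | h
  · exact mul_pos_of_neg_of_neg h (Real.sinh_neg_iff.mpr h)
  · exact mul_pos h (Real.sinh_pos_iff.mpr h)

section Exp

variable {A C : ℝ}

theorem im_mul_add_exp (A C : ℝ) (w : ℂ) : ((A : ℂ) * w + C * Complex.exp (2 * w)).im =
    A * w.im + C * Real.exp (2 * w.re) * (2 * Real.sin w.im * Real.cos w.im) := by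
  rw [← Real.sin_two_mul]
  simp [Complex.exp_im]
  ring

theorem im_mul_im_mul_add_exp_pos (hA : 0 < A) (hC : 0 < C) {w : ℂ} (hw : w ∈ halfPiStrip)
    (h0 : w.im ≠ 0) : 0 < w.im * ((A : ℂ) * w + C * Complex.exp (2 * w)).im := by
  rw [im_mul_add_exp]
  have h1 := mul_sin_pos hw h0
  have h2 := Real.cos_pos_of_mem_Ioo hw
  have h3 : 0 < w.im * w.im := mul_self_pos.mpr h0
  have : 0 < A * (w.im * w.im) + C * Real.exp (2 * w.re) * (2 * (w.im * Real.sin w.im)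
    * Real.cos w.im) := by positivity
  linarith

theorem injOn_mul_add_exp (hA : 0 < A) (hC : 0 < C) :
    Set.InjOn (fun w : ℂ => (A : ℂ) * w + C * Complex.exp (2 * w)) halfPiStrip := by
  intro a ha b hb hab
  by_contra hne
  have hd : ∀ w : ℂ, HasDerivAt (fun w : ℂ => (A : ℂ) * w + C * Complex.exp (2 * w))
      (A + 2 * C * Complex.exp (2 * w)) w := by
    intro w
    have h1 : HasDerivAt (fun w : ℂ => 2 * w) 2 w := by
      simpa using (hasDerivAt_id w).const_mul (2 : ℂ)
    have h2 := ((hasDerivAt_id w).const_mul (A : ℂ)).add (h1.cexp.const_mul (C : ℂ))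
    refine h2.congr_deriv ?_
    ring
  have key := exists_re_mul_deriv_eq_zero hne hab
    (F' := fun w => A + 2 * C * Complex.exp (2 * w)) (fun τ _ => hd _)
  rcases both_zero_or_mul_pos (congrArg Complex.im hab)
    (fun h => by beta_reduce; rw [im_mul_add_exp, h]; simp) (im_mul_im_mul_add_exp_pos hA hC ha)
    (fun h => by beta_reduce; rw [im_mul_add_exp, h]; simp) (im_mul_im_mul_add_exp_pos hA hC hb)
    with ⟨ha0, hb0⟩ | hm
  · obtain ⟨τ, _, h⟩ := key 1
    have : 0 < A + 2 * C * Real.exp (2 * (a + τ * (b - a)).re) := by positivity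
    simp [Complex.exp_re, ha0, hb0] at h
    simp at this
    linarith
  · obtain ⟨τ, hτ, h⟩ := key Complex.I
    have hs := segment_mem_halfPiStrip ha hb (Set.Ioo_subset_Icc_self hτ)
    have hne0 : (a + τ * (b - a)).im ≠ 0 := by
      simpa using add_mul_sub_mul_pos hm hτ
    generalize a + τ * (b - a) = w at *
    have h1 := mul_sin_pos hs hne0
    have h2 := Real.cos_pos_of_mem_Ioo hs
    have h3 : Real.sin w.im ≠ 0 := fun h => by simp [h] at h1
    simp [Complex.exp_im, Real.sin_two_mul, h2.ne', h3, hC.ne'] at h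

theorem isPreconnected_level_mul_add_exp (hA : 0 < A) (hC : 0 < C) {t : ℝ} (ht : 0 < t) :
    IsPreconnected {w : ℂ | w ∈ halfPiStrip ∧ ((A : ℂ) * w + C * Complex.exp (2 * w)).im = t} := by
  have hsc : ∀ v ∈ Set.Ioo 0 (min (π / 2) (t / A)),
      0 < t - A * v ∧ 0 < Real.sin v ∧ 0 < Real.cos v := by
    intro v hv
    have h1 := lt_min_iff.mp hv.2
    have h2 := (lt_div_iff₀ hA).mp h1.2
    exact ⟨by linarith, Real.sin_pos_of_pos_of_lt_pi hv.1 (by linarith [h1.1, Real.pi_pos]),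
      Real.cos_pos_of_mem_Ioo ⟨by linarith [hv.1, Real.pi_pos], h1.1⟩⟩
  have hp : ∀ v ∈ Set.Ioo 0 (min (π / 2) (t / A)),
      0 < (t - A * v) / (C * (2 * Real.sin v * Real.cos v)) := by
    intro v hv
    obtain ⟨h1, h2, h3⟩ := hsc v hv
    positivity
  let u : ℝ → ℝ := fun v => Real.log ((t - A * v) / (C * (2 * Real.sin v * Real.cos v))) / 2
  have hu : ContinuousOn u (Set.Ioo 0 (min (π / 2) (t / A))) := by
    refine (ContinuousOn.log (ContinuousOn.div (by fun_prop) (by fun_prop) ?_)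
      fun v hv => (hp v hv).ne').div_const 2
    intro v hv
    obtain ⟨h1, h2, h3⟩ := hsc v hv
    positivity
  convert isPreconnected_Ioo.image (fun v : ℝ => ((u v : ℂ) + v * Complex.I)) (by fun_prop)
    using 1
  ext w
  constructor
  · rintro ⟨hw, h⟩
    have hv0 : 0 < w.im := by
      by_cases h0 : w.im = 0
      · rw [im_mul_add_exp, h0] at h
        simp at h
        linarith
      · have := im_mul_im_mul_add_exp_pos hA hC hw h0
        rw [h] at this
        exact pos_of_mul_pos_left this ht.le
    rw [im_mul_add_exp] at h
    have h1 : 0 < Real.sin w.im :=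
      Real.sin_pos_of_pos_of_lt_pi hv0 (by linarith [hw.2, Real.pi_pos])
    have h2 := Real.cos_pos_of_mem_Ioo hw
    have h3 : 0 < C * Real.exp (2 * w.re) * (2 * Real.sin w.im * Real.cos w.im) := by positivity
    refine ⟨w.im, ⟨hv0, lt_min hw.2 ((lt_div_iff₀ hA).mpr (by linarith))⟩, ?_⟩
    have h4 : (t - A * w.im) / (C * (2 * Real.sin w.im * Real.cos w.im))
        = Real.exp (2 * w.re) := by
      rw [div_eq_iff (by positivity)]
      linarith
    apply Complex.ext <;> simp [u, h4]
  · rintro ⟨v, hv, rfl⟩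
    refine ⟨?_, ?_⟩
    · simp only [halfPiStrip, Set.mem_ofPred_eq]
      simpa using ⟨by linarith [hv.1, Real.pi_pos], (lt_min_iff.mp hv.2).1⟩
    · rw [im_mul_add_exp]
      obtain ⟨h1, h2, h3⟩ := hsc v hv
      have h4 : Real.exp (2 * u v) = (t - A * v) / (C * (2 * Real.sin v * Real.cos v)) := by
        simp only [u]
        rw [mul_div_cancel₀ _ two_ne_zero, Real.exp_log (hp v hv)]
      simp [h4]
      field_simp
      ring

theorem isHorizontalStripMap_mul_add_exp (hA : 0 < A) (hC : 0 < C) :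
    IsHorizontalStripMap (fun w : ℂ => (A : ℂ) * w + C * Complex.exp (2 * w)) where
  continuousOn := by fun_prop
  injOn := injOn_mul_add_exp hA hC
  level := isPreconnected_level_of_conj (fun w => by simp [← Complex.exp_conj, Complex.conj_ofNat])
    (fun w hw h => by
      by_contra h0
      have := im_mul_im_mul_add_exp_pos hA hC hw h0
      rw [h] at this
      simp at this)
    (fun _ ht => isPreconnected_level_mul_add_exp hA hC ht)

end Exp

section Tanh

variable {A C : ℝ}

theorem cosh_eq_re_im (w : ℂ) : Complex.cosh w =
    ⟨Real.cosh w.re * Real.cos w.im, Real.sinh w.re * Real.sin w.im⟩ := by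
  conv_lhs => rw [← Complex.re_add_im w]
  rw [Complex.cosh_add, Complex.cosh_mul_I, Complex.sinh_mul_I, ← Complex.ofReal_cosh,
    ← Complex.ofReal_sinh, ← Complex.ofReal_cos, ← Complex.ofReal_sin]
  apply Complex.ext <;> simp [-Complex.ofReal_cosh, -Complex.ofReal_sinh, -Complex.ofReal_cos,
    -Complex.ofReal_sin]

theorem sinh_eq_re_im (w : ℂ) : Complex.sinh w =
    ⟨Real.sinh w.re * Real.cos w.im, Real.cosh w.re * Real.sin w.im⟩ := by
  conv_lhs => rw [← Complex.re_add_im w]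
  rw [Complex.sinh_add, Complex.cosh_mul_I, Complex.sinh_mul_I, ← Complex.ofReal_cosh,
    ← Complex.ofReal_sinh, ← Complex.ofReal_cos, ← Complex.ofReal_sin]
  apply Complex.ext <;> simp [-Complex.ofReal_cosh, -Complex.ofReal_sinh, -Complex.ofReal_cos,
    -Complex.ofReal_sin]

theorem cosh_ne_zero_of_mem_halfPiStrip {w : ℂ} (hw : w ∈ halfPiStrip) : Complex.cosh w ≠ 0 := by
  intro h
  rw [cosh_eq_re_im] at h
  have := mul_pos (Real.cosh_pos w.re) (Real.cos_pos_of_mem_Ioo hw)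
  exact this.ne' (congrArg Complex.re h)

theorem tanh_eq_re_im (w : ℂ) : Complex.tanh w =
    ⟨Real.sinh w.re * Real.cosh w.re / (Real.sinh w.re ^ 2 + Real.cos w.im ^ 2),
      Real.sin w.im * Real.cos w.im / (Real.sinh w.re ^ 2 + Real.cos w.im ^ 2)⟩ := by
  have hn : Complex.normSq (Complex.cosh w) = Real.sinh w.re ^ 2 + Real.cos w.im ^ 2 := by
    rw [cosh_eq_re_im, Complex.normSq_mk]
    linear_combination Real.cos w.im ^ 2 * Real.cosh_sq w.re
      + Real.sinh w.re ^ 2 * Real.sin_sq_add_cos_sq w.im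
  rw [Complex.tanh_eq_sinh_div_cosh]
  apply Complex.ext
  · rw [Complex.div_re, hn, ← add_div, cosh_eq_re_im, sinh_eq_re_im]
    congr 1
    linear_combination Real.sinh w.re * Real.cosh w.re * Real.sin_sq_add_cos_sq w.im
  · rw [Complex.div_im, hn, ← sub_div, cosh_eq_re_im, sinh_eq_re_im]
    congr 1
    linear_combination Real.sin w.im * Real.cos w.im * Real.cosh_sq w.re

theorem im_mul_add_tanh (A C : ℝ) (w : ℂ) : ((A : ℂ) * w + C * Complex.tanh w).im =
    A * w.im + C * (Real.sin w.im * Real.cos w.im) /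
      (Real.sinh w.re ^ 2 + Real.cos w.im ^ 2) := by
  rw [tanh_eq_re_im]
  simp [mul_div_assoc]

theorem re_mul_add_tanh (A C : ℝ) (w : ℂ) : ((A : ℂ) * w + C * Complex.tanh w).re =
    A * w.re + C * (Real.sinh w.re * Real.cosh w.re) /
      (Real.sinh w.re ^ 2 + Real.cos w.im ^ 2) := by
  rw [tanh_eq_re_im]
  simp [mul_div_assoc]

theorem im_mul_im_mul_add_tanh_pos (hA : 0 < A) (hC : 0 < C) {w : ℂ} (hw : w ∈ halfPiStrip)
    (h0 : w.im ≠ 0) : 0 < w.im * ((A : ℂ) * w + C * Complex.tanh w).im := by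
  rw [im_mul_add_tanh]
  have h1 := mul_sin_pos hw h0
  have h2 := Real.cos_pos_of_mem_Ioo hw
  have h3 : 0 < w.im * w.im := mul_self_pos.mpr h0
  have : 0 < A * (w.im * w.im) + C * (w.im * Real.sin w.im * Real.cos w.im) /
      (Real.sinh w.re ^ 2 + Real.cos w.im ^ 2) := by positivity
  convert this using 1
  ring

theorem re_mul_re_mul_add_tanh_pos (hA : 0 < A) (hC : 0 < C) {w : ℂ} (hw : w ∈ halfPiStrip)
    (h0 : w.re ≠ 0) : 0 < w.re * ((A : ℂ) * w + C * Complex.tanh w).re := by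
  rw [re_mul_add_tanh]
  have h1 := mul_sinh_pos h0
  have h2 := Real.cos_pos_of_mem_Ioo hw
  have h3 : 0 < w.re * w.re := mul_self_pos.mpr h0
  have : 0 < A * (w.re * w.re) + C * (w.re * Real.sinh w.re * Real.cosh w.re) /
      (Real.sinh w.re ^ 2 + Real.cos w.im ^ 2) := by
    have := Real.cosh_pos w.re
    positivity
  convert this using 1
  ring

theorem hasDerivAt_mul_add_tanh (A C : ℝ) {w : ℂ} (hw : w ∈ halfPiStrip) :
    HasDerivAt (fun w : ℂ => (A : ℂ) * w + C * Complex.tanh w)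
      (A + C / Complex.cosh w ^ 2) w := by
  have h1 : HasDerivAt Complex.tanh (1 / Complex.cosh w ^ 2) w := by
    have h := (Complex.hasDerivAt_sinh w).div (Complex.hasDerivAt_cosh w)
      (cosh_ne_zero_of_mem_halfPiStrip hw)
    refine (h.congr_of_eventuallyEq ?_).congr_deriv ?_
    · exact Filter.Eventually.of_forall fun z => Complex.tanh_eq_sinh_div_cosh z
    · congr 1
      linear_combination Complex.cosh_sq_sub_sinh_sq w
  refine (((hasDerivAt_id w).const_mul (A : ℂ)).add (h1.const_mul (C : ℂ))).congr_deriv ?_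
  ring

theorem re_add_div_cosh_sq_pos (hA : 0 < A) (hC : 0 < C) {w : ℂ} (hw : w ∈ halfPiStrip)
    (h0 : w.re = 0 ∨ w.im = 0) : 0 < ((A : ℂ) + C / Complex.cosh w ^ 2).re := by
  have hr := mul_pos (Real.cosh_pos w.re) (Real.cos_pos_of_mem_Ioo hw)
  have h1 : Complex.cosh w = ((Real.cosh w.re * Real.cos w.im : ℝ) : ℂ) := by
    rw [cosh_eq_re_im]
    apply Complex.ext
    · rw [Complex.ofReal_re]
    · rw [Complex.ofReal_im]
      rcases h0 with h | h <;> simp [h]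
  rw [h1, ← Complex.ofReal_pow, ← Complex.ofReal_div, ← Complex.ofReal_add, Complex.ofReal_re]
  positivity

theorem im_add_div_cosh_sq_ne_zero (A : ℝ) (hC : 0 < C) {w : ℂ} (hw : w ∈ halfPiStrip)
    (hre : w.re ≠ 0) (him : w.im ≠ 0) : ((A : ℂ) + C / Complex.cosh w ^ 2).im ≠ 0 := by
  have h1 : Real.sin w.im ≠ 0 := fun h => by simpa [h] using mul_sin_pos hw him
  have h2 := (Real.cos_pos_of_mem_Ioo hw).ne'
  have h3 := (Real.cosh_pos w.re).ne'
  have h4 : Real.sinh w.re ≠ 0 := fun h => by simpa [h] using mul_sinh_pos hre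
  have h5 : (Complex.cosh w ^ 2).im =
      2 * (Real.cosh w.re * Real.cos w.im) * (Real.sinh w.re * Real.sin w.im) := by
    rw [cosh_eq_re_im, sq]
    simp only [Complex.mul_im]
    ring
  have h6 : (Complex.cosh w ^ 2).im ≠ 0 := by
    rw [h5]
    positivity
  have h7 : Complex.normSq (Complex.cosh w ^ 2) ≠ 0 := by
    rw [Ne, Complex.normSq_eq_zero]
    exact pow_ne_zero 2 (cosh_ne_zero_of_mem_halfPiStrip hw)
  rw [Complex.add_im, Complex.ofReal_im, zero_add, Complex.div_im, Complex.ofReal_im,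
    Complex.ofReal_re, zero_mul, zero_div, zero_sub, neg_ne_zero]
  exact div_ne_zero (mul_ne_zero hC.ne' h6) h7

theorem injOn_mul_add_tanh (hA : 0 < A) (hC : 0 < C) :
    Set.InjOn (fun w : ℂ => (A : ℂ) * w + C * Complex.tanh w) halfPiStrip := by
  intro a ha b hb hab
  by_contra hne
  have hs : ∀ τ ∈ Set.Icc (0 : ℝ) 1, a + τ * (b - a) ∈ halfPiStrip :=
    fun τ hτ => segment_mem_halfPiStrip ha hb hτ
  have key := exists_re_mul_deriv_eq_zero hne hab (F' := fun w => A + C / Complex.cosh w ^ 2)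
    (fun τ hτ => hasDerivAt_mul_add_tanh A C (hs τ hτ))
  have hIm := both_zero_or_mul_pos (congrArg Complex.im hab)
    (fun h => by beta_reduce; rw [im_mul_add_tanh, h]; simp) (im_mul_im_mul_add_tanh_pos hA hC ha)
    (fun h => by beta_reduce; rw [im_mul_add_tanh, h]; simp) (im_mul_im_mul_add_tanh_pos hA hC hb)
  have hRe := both_zero_or_mul_pos (congrArg Complex.re hab)
    (fun h => by beta_reduce; rw [re_mul_add_tanh, h]; simp) (re_mul_re_mul_add_tanh_pos hA hC ha)
    (fun h => by beta_reduce; rw [re_mul_add_tanh, h]; simp) (re_mul_re_mul_add_tanh_pos hA hC hb)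
  by_cases haxis : (a.re = 0 ∧ b.re = 0) ∨ (a.im = 0 ∧ b.im = 0)
  · obtain ⟨τ, hτ, h⟩ := key 1
    have := re_add_div_cosh_sq_pos hA hC (hs τ (Set.Ioo_subset_Icc_self hτ)) (by
      rcases haxis with h | h
      · left; simp [h.1, h.2]
      · right; simp [h.1, h.2])
    rw [one_mul] at h
    exact this.ne' h
  · obtain ⟨τ, hτ, h⟩ := key Complex.I
    rw [not_or] at haxis
    refine im_add_div_cosh_sq_ne_zero A hC (hs τ (Set.Ioo_subset_Icc_self hτ)) ?_ ?_
      (by simpa [Complex.mul_re] using h)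
    · simpa using add_mul_sub_mul_pos (hRe.resolve_left haxis.1) hτ
    · simpa using add_mul_sub_mul_pos (hIm.resolve_left haxis.2) hτ

theorem isPreconnected_level_mul_add_tanh (hA : 0 < A) (hC : 0 < C) {t : ℝ} (ht : 0 < t) :
    IsPreconnected {w : ℂ | w ∈ halfPiStrip ∧ ((A : ℂ) * w + C * Complex.tanh w).im = t} := by
  set m : ℝ := min (π / 2) (t / A) with hm
  have hm0 : 0 < m := lt_min (by positivity) (by positivity)
  have hmpi : m ≤ π / 2 := min_le_left _ _
  have hmA : A * m ≤ t := by
    have := (le_div_iff₀ hA).mp (min_le_right (π / 2) (t / A))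
    linarith
  have hsc : ∀ v ∈ Set.Ioo 0 m, 0 < t - A * v ∧ 0 < Real.sin v ∧ 0 < Real.cos v := by
    intro v hv
    have := mul_lt_mul_of_pos_left hv.2 hA
    exact ⟨by linarith, Real.sin_pos_of_pos_of_lt_pi hv.1 (by linarith [hv.2, Real.pi_pos]),
      Real.cos_pos_of_mem_Ioo ⟨by linarith [hv.1, Real.pi_pos], by linarith [hv.2]⟩⟩
  let K : ℝ → ℝ := fun v => C * Real.sin v - (t - A * v) * Real.cos v
  have hK : StrictMonoOn K (Set.Ioo 0 m) := by
    intro x hx y hy hxy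
    have h1 : Real.sin x < Real.sin y := Real.sin_lt_sin_of_lt_of_le_pi_div_two
      (by linarith [hx.1, Real.pi_pos]) (by linarith [hy.2]) hxy
    have h2 : Real.cos y < Real.cos x :=
      Real.cos_lt_cos_of_nonneg_of_le_pi hx.1.le (by linarith [hy.2, Real.pi_pos]) hxy
    have h3 : (t - A * y) * Real.cos y < (t - A * x) * Real.cos x := by
      have := mul_lt_mul_of_pos_left hxy hA
      exact mul_lt_mul'' (by linarith) h2 (hsc y hy).1.le (hsc y hy).2.2.le
    have h4 := mul_lt_mul_of_pos_left h1 hC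
    simp only [K]
    linarith
  obtain ⟨v₀, hv₀, hKv₀⟩ : (0 : ℝ) ∈ K '' Set.Ioo 0 m := by
    refine intermediate_value_Ioo hm0.le (by fun_prop) ⟨by simp [K, ht], ?_⟩
    have h1 : (t - A * m) * Real.cos m = 0 := by
      rcases min_choice (π / 2) (t / A) with h | h
      · rw [hm, h, Real.cos_pi_div_two, mul_zero]
      · rw [hm, h, mul_div_cancel₀ _ hA.ne', sub_self, zero_mul]
    have h2 := Real.sin_pos_of_pos_of_lt_pi hm0 (by linarith [Real.pi_pos])
    simp only [K, h1, sub_zero]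
    positivity
  have hJ : ∀ v ∈ Set.Ico v₀ m, v ∈ Set.Ioo 0 m := fun v hv => ⟨hv₀.1.trans_le hv.1, hv.2⟩
  let H : ℝ → ℝ := fun v =>
    C * (Real.sin v * Real.cos v) / (t - A * v) - Real.cos v ^ 2
  have hHK : ∀ v ∈ Set.Ioo 0 m, H v = K v * (Real.cos v / (t - A * v)) := by
    intro v hv
    have := (hsc v hv).1.ne'
    simp only [H, K]
    field_simp
  have hH : ∀ v ∈ Set.Ico v₀ m, 0 ≤ H v := by
    intro v hv
    obtain ⟨h1, h2, h3⟩ := hsc v (hJ v hv)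
    rw [hHK v (hJ v hv)]
    have := hK.monotoneOn hv₀ (hJ v hv) hv.1
    rw [hKv₀] at this
    positivity
  let u : ℝ → ℝ := fun v => Real.arsinh √(H v)
  have hu : ContinuousOn u (Set.Ico v₀ m) := by
    refine Real.continuous_arsinh.comp_continuousOn (ContinuousOn.sqrt ?_)
    exact ((ContinuousOn.div (by fun_prop) (by fun_prop)
      fun v hv => (hsc v (hJ v hv)).1.ne')).sub (by fun_prop)
  have hu₀ : u v₀ = 0 := by simp [u, hHK v₀ hv₀, hKv₀]
  have hmem : ∀ v ∈ Set.Ico v₀ m, ∀ x : ℝ, Real.sinh x ^ 2 = H v →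
      (x : ℂ) + v * Complex.I ∈
        {w : ℂ | w ∈ halfPiStrip ∧ ((A : ℂ) * w + C * Complex.tanh w).im = t} := by
    intro v hv x hx
    obtain ⟨h1, h2, h3⟩ := hsc v (hJ v hv)
    refine ⟨?_, ?_⟩
    · simp only [halfPiStrip, Set.mem_ofPred_eq]
      simpa using ⟨by linarith [(hJ v hv).1, Real.pi_pos], hv.2.trans_le hmpi⟩
    · rw [im_mul_add_tanh]
      simp only [Complex.add_re, Complex.ofReal_re, Complex.re_ofReal_mul, Complex.I_re, mul_zero,
        add_zero, Complex.add_im, Complex.ofReal_im, Complex.im_ofReal_mul, Complex.I_im, mul_one,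
        zero_add, hx, H, sub_add_cancel]
      field_simp
      ring
  convert IsPreconnected.union ((v₀ : ℂ) * Complex.I) ?_ ?_
    (isPreconnected_Ico.image (fun v : ℝ => ((u v : ℂ) + v * Complex.I)) (by fun_prop))
    (isPreconnected_Ico.image (fun v : ℝ => (((-u v : ℝ) : ℂ) + v * Complex.I)) (by fun_prop))
    using 1
  · ext w
    constructor
    · rintro ⟨hw, h⟩
      have hv0 : 0 < w.im := by
        by_cases h0 : w.im = 0
        · rw [im_mul_add_tanh, h0] at h
          simp at h
          linarith
        · have := im_mul_im_mul_add_tanh_pos hA hC hw h0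
          rw [h] at this
          exact pos_of_mul_pos_left this ht.le
      rw [im_mul_add_tanh] at h
      have h1 : 0 < Real.sin w.im :=
        Real.sin_pos_of_pos_of_lt_pi hv0 (by linarith [hw.2, Real.pi_pos])
      have h2 := Real.cos_pos_of_mem_Ioo hw
      have hN : 0 < Real.sinh w.re ^ 2 + Real.cos w.im ^ 2 := by positivity
      have h3 : 0 < C * (Real.sin w.im * Real.cos w.im) /
          (Real.sinh w.re ^ 2 + Real.cos w.im ^ 2) := by positivity
      have hvm : w.im ∈ Set.Ioo 0 m :=
        ⟨hv0, lt_min hw.2 ((lt_div_iff₀ hA).mpr (by linarith))⟩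
      have hHw : H w.im = Real.sinh w.re ^ 2 := by
        have h4 := (hsc _ hvm).1
        have h5 : C * (Real.sin w.im * Real.cos w.im) / (t - A * w.im) =
            Real.sinh w.re ^ 2 + Real.cos w.im ^ 2 := by
          have h6 := eq_sub_of_add_eq' h
          rw [div_eq_iff hN.ne'] at h6
          rw [div_eq_iff h4.ne', h6, mul_comm]
        simp only [H, h5, add_sub_cancel_right]
      have hv₀w : v₀ ≤ w.im := by
        by_contra! hlt
        have h4 := hK hvm hv₀ hlt
        rw [hKv₀] at h4
        have h5 := mul_neg_of_neg_of_pos h4 (div_pos h2 (hsc _ hvm).1)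
        rw [← hHK _ hvm, hHw] at h5
        linarith [sq_nonneg (Real.sinh w.re)]
      have huw : u w.im = Real.arsinh |Real.sinh w.re| := by
        simp only [u, hHw, Real.sqrt_sq_eq_abs]
      rcases abs_choice (Real.sinh w.re) with h4 | h4
      · left
        refine ⟨w.im, ⟨hv₀w, hvm.2⟩, ?_⟩
        rw [h4, Real.arsinh_sinh] at huw
        simp [huw]
      · right
        refine ⟨w.im, ⟨hv₀w, hvm.2⟩, ?_⟩
        rw [h4, Real.arsinh_neg, Real.arsinh_sinh] at huw
        simp [huw]
    · rintro (⟨v, hv, rfl⟩ | ⟨v, hv, rfl⟩)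
      · exact hmem v hv _ (by simp [u, Real.sq_sqrt (hH v hv)])
      · exact hmem v hv _ (by simp [u, Real.sq_sqrt (hH v hv)])
  · exact ⟨v₀, ⟨le_rfl, hv₀.2⟩, by simp [hu₀]⟩
  · exact ⟨v₀, ⟨le_rfl, hv₀.2⟩, by simp [hu₀]⟩

theorem isHorizontalStripMap_mul_add_tanh (hA : 0 < A) (hC : 0 < C) :
    IsHorizontalStripMap (fun w : ℂ => (A : ℂ) * w + C * Complex.tanh w) where
  continuousOn := fun _ hw =>
    (hasDerivAt_mul_add_tanh A C hw).continuousAt.continuousWithinAt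
  injOn := injOn_mul_add_tanh hA hC
  level := isPreconnected_level_of_conj (fun w => by simp [← Complex.tanh_conj])
    (fun w hw h => by
      by_contra h0
      have := im_mul_im_mul_add_tanh_pos hA hC hw h0
      rw [h] at this
      simp at this)
    (fun _ ht => isPreconnected_level_mul_add_tanh hA hC ht)

end Tanh

theorem re_one_add_div_one_sub_pos {z : ℂ} (hz : z ∈ unitDisk) : 0 < ((1 + z) / (1 - z)).re := by
  have hz1 : ‖z‖ < 1 := by simpa [unitDisk] using hz
  have h1 : 1 - z ≠ 0 := fun h => by
    rw [← sub_eq_zero.mp h] at hz1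
    simp at hz1
  have h2 : 0 < Complex.normSq (1 - z) := Complex.normSq_pos.mpr h1
  have h3 : Complex.normSq z < 1 := by
    rw [Complex.normSq_eq_norm_sq]
    exact pow_lt_one₀ (norm_nonneg z) hz1 two_ne_zero
  rw [Complex.normSq_apply] at h3
  rw [Complex.div_re, ← add_div]
  refine div_pos ?_ h2
  simp
  linarith

theorem one_sub_ne_zero_of_mem_unitDisk {z : ℂ} (hz : z ∈ unitDisk) : 1 - z ≠ 0 := fun h => by
  simpa [h] using re_one_add_div_one_sub_pos hz

theorem one_add_ne_zero_of_mem_unitDisk {z : ℂ} (hz : z ∈ unitDisk) : 1 + z ≠ 0 := fun h => by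
  simpa [h] using re_one_add_div_one_sub_pos hz

theorem bijOn_log_unitDisk_halfPiStrip :
    Set.BijOn (fun z : ℂ => Complex.log ((1 + z) / (1 - z))) unitDisk halfPiStrip := by
  refine ⟨fun z hz => ?_, fun a ha b hb h => ?_, fun w hw => ?_⟩
  · have h := Complex.abs_arg_lt_pi_div_two_iff.mpr (Or.inl (re_one_add_div_one_sub_pos hz))
    simpa [halfPiStrip, Complex.log_im] using abs_lt.mp h
  · have ha1 := one_sub_ne_zero_of_mem_unitDisk ha
    have hb1 := one_sub_ne_zero_of_mem_unitDisk hb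
    have h1 := congrArg Complex.exp h
    simp only at h1
    rw [Complex.exp_log (div_ne_zero (one_add_ne_zero_of_mem_unitDisk ha) ha1),
      Complex.exp_log (div_ne_zero (one_add_ne_zero_of_mem_unitDisk hb) hb1),
      div_eq_div_iff ha1 hb1] at h1
    linear_combination h1 / 2
  · have hre : 0 < (Complex.exp w).re := by
      rw [Complex.exp_re]
      exact mul_pos (Real.exp_pos _) (Real.cos_pos_of_mem_Ioo hw)
    have h1 : Complex.exp w + 1 ≠ 0 := fun h => by
      have := congrArg Complex.re h
      simp only [Complex.add_re, Complex.one_re, Complex.zero_re] at this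
      linarith
    refine ⟨(Complex.exp w - 1) / (Complex.exp w + 1), ?_, ?_⟩
    · have hlt : ‖Complex.exp w - 1‖ < ‖Complex.exp w + 1‖ := by
        refine lt_of_pow_lt_pow_left₀ 2 (norm_nonneg _) ?_
        rw [← Complex.normSq_eq_norm_sq, ← Complex.normSq_eq_norm_sq, Complex.normSq_apply,
          Complex.normSq_apply]
        simp only [Complex.sub_re, Complex.sub_im, Complex.add_re, Complex.add_im, Complex.one_re,
          Complex.one_im]
        linarith
      rw [unitDisk, mem_ball_zero_iff, norm_div, div_lt_one (norm_pos_iff.mpr h1)]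
      exact hlt
    · have h2 : (1 + (Complex.exp w - 1) / (Complex.exp w + 1)) /
          (1 - (Complex.exp w - 1) / (Complex.exp w + 1)) = Complex.exp w := by
        have h3 : 1 - (Complex.exp w - 1) / (Complex.exp w + 1) = 2 / (Complex.exp w + 1) := by
          field_simp
          ring
        rw [h3]
        field_simp
        ring
      simp only [h2]
      exact Complex.log_exp (by linarith [hw.1, Real.pi_pos]) (by linarith [hw.2, Real.pi_pos])

theorem one_add_mul_add_sq_ne_zero {c : ℝ} (hc : c ∈ Set.Icc (-2 : ℝ) 2) {z : ℂ}
    (hz : z ∈ unitDisk) : 1 + (c : ℂ) * z + z ^ 2 ≠ 0 := by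
  intro h
  have hz1 : ‖z‖ < 1 := by simpa [unitDisk] using hz
  have h3 : Complex.normSq z < 1 := by
    rw [Complex.normSq_eq_norm_sq]
    exact pow_lt_one₀ (norm_nonneg z) hz1 two_ne_zero
  rw [Complex.normSq_apply] at h3
  have hre := congrArg Complex.re h
  have him := congrArg Complex.im h
  simp [sq] at hre him
  have him' : z.im * (c + 2 * z.re) = 0 := by linear_combination him
  rcases mul_eq_zero.mp him' with h0 | h0
  · rw [h0] at hre h3
    have h4 : -1 < z.re := by nlinarith
    have h5 : z.re < 1 := by nlinarith
    rcases le_total 0 z.re with h6 | h6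
    · nlinarith [mul_nonneg h6 (by linarith [hc.1] : 0 ≤ c + 2),
        mul_pos (sub_pos.mpr h5) (sub_pos.mpr h5)]
    · nlinarith [mul_nonneg (neg_nonneg.mpr h6) (by linarith [hc.2] : 0 ≤ 2 - c),
        mul_pos (neg_lt_iff_pos_add.mp h4) (neg_lt_iff_pos_add.mp h4)]
  · have : c = -2 * z.re := by linarith
    rw [this] at hre
    linarith

theorem tanh_eq_exp_two_mul (w : ℂ) :
    Complex.tanh w = (Complex.exp (2 * w) - 1) / (Complex.exp (2 * w) + 1) := by
  have h := Complex.exp_ne_zero w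
  have h2 : Complex.exp (2 * w) = Complex.exp w * Complex.exp w := by
    rw [← Complex.exp_add, two_mul]
  rw [Complex.tanh_eq_sinh_div_cosh, Complex.sinh, Complex.cosh, div_div_div_cancel_right₀
    two_ne_zero, Complex.exp_neg, h2, ← mul_div_mul_left _ _ h]
  congr 1 <;> field_simp

theorem exists_isHorizontalStripMap_eq_comp_log {A B c : ℝ} (hA : 0 < A) (hB : 0 < B)
    (hc : c ∈ Set.Icc (-2 : ℝ) 2) :
    ∃ F : ℂ → ℂ, IsHorizontalStripMap F ∧ ∀ z ∈ unitDisk,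
      (A : ℂ) * Complex.log ((1 + z) / (1 - z)) + (B : ℂ) * z / (1 + (c : ℂ) * z + z ^ 2) =
        F (Complex.log ((1 + z) / (1 - z))) := by
  have hexp : ∀ z ∈ unitDisk,
      Complex.exp (2 * Complex.log ((1 + z) / (1 - z))) = ((1 + z) / (1 - z)) ^ 2 := by
    intro z hz
    have h : (1 + z) / (1 - z) ≠ 0 := div_ne_zero (one_add_ne_zero_of_mem_unitDisk hz)
      (one_sub_ne_zero_of_mem_unitDisk hz)
    rw [two_mul, Complex.exp_add, Complex.exp_log h, sq]
  have hE := isHorizontalStripMap_mul_add_exp hA (show 0 < B / 4 by positivity)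
  rcases eq_or_lt_of_le hc.1 with h | h1
  · refine ⟨_, hE.add_real (-(B / 4)), fun z hz => ?_⟩
    have h1 := one_sub_ne_zero_of_mem_unitDisk hz
    have h2 : 1 + (c : ℂ) * z + z ^ 2 = (1 - z) ^ 2 := by
      rw [← h]
      push_cast
      ring
    rw [hexp z hz, h2]
    push_cast
    field_simp
    ring
  rcases eq_or_lt_of_le hc.2 with h | h2
  · refine ⟨_, hE.neg_comp_neg.add_real (B / 4), fun z hz => ?_⟩
    have h1 := one_sub_ne_zero_of_mem_unitDisk hz
    have h2 := one_add_ne_zero_of_mem_unitDisk hz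
    have h3 : 1 + (c : ℂ) * z + z ^ 2 = (1 + z) ^ 2 := by
      rw [h]
      push_cast
      ring
    rw [mul_neg 2, Complex.exp_neg, hexp z hz, h3]
    push_cast
    field_simp
    ring
  · have hp : 0 < 2 + c := by linarith
    have hq : 0 < 2 - c := by linarith
    set δ : ℝ := Real.log ((2 + c) / (2 - c)) / 2 with hδ
    have hC : 0 < 2 * B / ((2 + c) * (2 - c)) := by positivity
    refine ⟨_, ((isHorizontalStripMap_mul_add_tanh hA hC).comp_add_real δ).add_real
      (-(B * c / ((2 + c) * (2 - c))) - A * δ), fun z hz => ?_⟩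
    have h3 : Complex.exp (2 * (Complex.log ((1 + z) / (1 - z)) + δ)) =
        ((1 + z) / (1 - z)) ^ 2 * ((2 + c) / (2 - c)) := by
      have h4 : Real.exp (2 * δ) = (2 + c) / (2 - c) := by
        rw [hδ, mul_div_cancel₀ _ two_ne_zero, Real.exp_log (by positivity)]
      rw [mul_add, Complex.exp_add, hexp z hz]
      congr 1
      exact_mod_cast congrArg Complex.ofReal h4
    have h5 := one_sub_ne_zero_of_mem_unitDisk hz
    have h6 := one_add_mul_add_sq_ne_zero hc hz
    have hp' : (2 + c : ℂ) ≠ 0 := by exact_mod_cast hp.ne'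
    have hq' : (2 - c : ℂ) ≠ 0 := by exact_mod_cast hq.ne'
    have h7 : Complex.tanh (Complex.log ((1 + z) / (1 - z)) + δ) =
        c / 2 + (2 + c) * (2 - c) / 2 * (z / (1 + (c : ℂ) * z + z ^ 2)) := by
      rw [tanh_eq_exp_two_mul, h3]
      have h8 : ((1 + z) / (1 - z)) ^ 2 * ((2 + c) / (2 - c)) - 1 =
          2 * (c + 4 * z + c * z ^ 2) / ((1 - z) ^ 2 * (2 - c)) := by
        field_simp
        ring
      have h9 : ((1 + z) / (1 - z)) ^ 2 * ((2 + c) / (2 - c)) + 1 =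
          4 * (1 + (c : ℂ) * z + z ^ 2) / ((1 - z) ^ 2 * (2 - c)) := by
        field_simp
        ring
      rw [h8, h9, div_div_div_cancel_right₀ (by positivity)]
      field_simp
      ring
    rw [h7, mul_div_assoc (B : ℂ)]
    generalize z / (1 + (c : ℂ) * z + z ^ 2) = q
    push_cast
    field_simp
    ring

theorem four_slit_mapping_univalent_CHD
    (A B c : ℝ) (hA : 0 < A) (hB : 0 < B) (hc : c ∈ Set.Icc (-2 : ℝ) 2) :
    let φ : ℂ → ℂ := fun z =>
      (A : ℂ) * Complex.log ((1 + z) / (1 - z)) + (B : ℂ) * z / (1 + (c : ℂ) * z + z ^ 2)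
    DifferentiableOn ℂ φ unitDisk ∧ Set.InjOn φ unitDisk ∧ IsCHD (φ '' unitDisk) := by
  intro φ
  obtain ⟨F, hF, hφ⟩ := exists_isHorizontalStripMap_eq_comp_log hA hB hc
  have hbij := bijOn_log_unitDisk_halfPiStrip
  have hφF : Set.EqOn φ (F ∘ fun z => Complex.log ((1 + z) / (1 - z))) unitDisk := hφ
  refine ⟨?_, ?_, ?_⟩
  · refine DifferentiableOn.add (DifferentiableOn.const_mul (DifferentiableOn.clog ?_ ?_) _) ?_
    · exact DifferentiableOn.div (by fun_prop) (by fun_prop)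
        fun z hz => one_sub_ne_zero_of_mem_unitDisk hz
    · exact fun z hz => Or.inl (re_one_add_div_one_sub_pos hz)
    · exact DifferentiableOn.div (by fun_prop) (by fun_prop)
        fun z hz => one_add_mul_add_sq_ne_zero hc hz
  · exact (hF.injOn.comp hbij.injOn hbij.mapsTo).congr hφF.symm
  · rw [hφF.image_eq, Set.image_comp, hbij.image_eq]
    exact hF.isCHD_image
end
end

section
/- For real A, B > 0, the function φ(z) = A·Log((1+z)/(1−z)) + B·z/(1−z)² (the case c = −2 of the slit mapping) is injective on 𝔻, and φ(𝔻) = ℂ \ { x ± (Aπ/2)i : x ∈ ℝ, x ≤ (A/2)·log(2A/B) − (2A+B)/4 }, i.e. the complex plane minus the two horizontal half-lines extending to −∞ at heights ±Aπ/2 with right endpoint (A/2)·log(2A/B) − (2A+B)/4. -/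
open Complex Set
open scoped Real

noncomputable section

open scoped Topology

/-- Real part of `A log w + B (w² - 1) / 4` at `w = r e^{iθ}`. -/
def polarRe (A B r θ : ℝ) : ℝ := A * Real.log r + B / 4 * (r ^ 2 * Real.cos (2 * θ) - 1)

/-- Imaginary part of `A log w + B (w² - 1) / 4` at `w = r e^{iθ}`. -/
def polarIm (A B r θ : ℝ) : ℝ := A * θ + B / 4 * (r ^ 2 * Real.sin (2 * θ))

/-- The value of `polarRe` along the level set `polarIm = v`, as a function of the angle. -/
def levelRe (A B v θ : ℝ) : ℝ :=
  A / 2 * (Real.log (4 * (v - A * θ) / B) - Real.log (Real.sin (2 * θ)))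
    + (v - A * θ) * Real.cos (2 * θ) / Real.sin (2 * θ) - B / 4

lemma polarRe_neg (A B r θ : ℝ) : polarRe A B r (-θ) = polarRe A B r θ := by
  simp [polarRe]

lemma polarIm_neg (A B r θ : ℝ) : polarIm A B r (-θ) = -polarIm A B r θ := by
  simp [polarIm]; ring

lemma sin_two_mul_pos {θ : ℝ} (h0 : 0 < θ) (h1 : θ < π / 2) : 0 < Real.sin (2 * θ) :=
  Real.sin_pos_of_pos_of_lt_pi (by linarith) (by linarith)

lemma polarIm_pos {A B r θ : ℝ} (hA : 0 < A) (hB : 0 < B) (h0 : 0 < θ) (h1 : θ < π / 2) :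
    0 < polarIm A B r θ := by
  have := sin_two_mul_pos h0 h1
  unfold polarIm
  positivity

lemma lt_of_polarIm_eq {A B r θ v : ℝ} (hB : 0 < B) (hr : 0 < r) (h0 : 0 < θ)
    (h1 : θ < π / 2) (hv : polarIm A B r θ = v) : A * θ < v := by
  have := sin_two_mul_pos h0 h1
  have : 0 < B / 4 * (r ^ 2 * Real.sin (2 * θ)) := by positivity
  unfold polarIm at hv
  linarith

lemma sq_eq_of_polarIm_eq {A B r θ v : ℝ} (hB : 0 < B) (h0 : 0 < θ)
    (h1 : θ < π / 2) (hv : polarIm A B r θ = v) :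
    r ^ 2 = 4 * (v - A * θ) / B / Real.sin (2 * θ) := by
  have := sin_two_mul_pos h0 h1
  rw [← hv, polarIm]
  generalize Real.sin (2 * θ) = s at this
  field_simp
  ring

lemma polarRe_eq_levelRe {A B r θ v : ℝ} (hB : 0 < B) (hr : 0 < r) (h0 : 0 < θ)
    (h1 : θ < π / 2) (hv : polarIm A B r θ = v) : polarRe A B r θ = levelRe A B v θ := by
  have hs := sin_two_mul_pos h0 h1
  have hlt := lt_of_polarIm_eq hB hr h0 h1 hv
  have hsq := sq_eq_of_polarIm_eq hB h0 h1 hv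
  have hy : 0 < 4 * (v - A * θ) / B := by
    have : 0 < v - A * θ := by linarith
    positivity
  have hlog : Real.log r = 1 / 2 *
      (Real.log (4 * (v - A * θ) / B) - Real.log (Real.sin (2 * θ))) := by
    rw [← Real.log_div hy.ne' hs.ne', ← hsq, Real.log_pow]
    push_cast
    ring
  rw [polarRe, levelRe, hlog, hsq]
  field_simp
  ring

lemma exists_polar_of_levelRe {A B θ v : ℝ} (hB : 0 < B) (h0 : 0 < θ)
    (h1 : θ < π / 2) (hlt : A * θ < v) :
    ∃ r > 0, polarRe A B r θ = levelRe A B v θ ∧ polarIm A B r θ = v := by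
  have hs := sin_two_mul_pos h0 h1
  have hy : 0 < v - A * θ := by linarith
  have hpos : 0 < 4 * (v - A * θ) / B / Real.sin (2 * θ) := by positivity
  have hv : polarIm A B (√(4 * (v - A * θ) / B / Real.sin (2 * θ))) θ = v := by
    rw [polarIm, Real.sq_sqrt hpos.le]
    generalize Real.sin (2 * θ) = s at hs
    field_simp
    ring
  exact ⟨_, Real.sqrt_pos.2 hpos, polarRe_eq_levelRe hB (Real.sqrt_pos.2 hpos) h0 h1 hv, hv⟩

lemma hasDerivAt_levelRe {A B v θ : ℝ} (hB : 0 < B) (h0 : 0 < θ) (h1 : θ < π / 2)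
    (hlt : A * θ < v) :
    HasDerivAt (levelRe A B v)
      (-((A + 2 * (v - A * θ) * Real.cos (2 * θ) / Real.sin (2 * θ)) ^ 2
        + 4 * (v - A * θ) ^ 2) / (2 * (v - A * θ))) θ := by
  have hs := sin_two_mul_pos h0 h1
  have hy : 0 < v - A * θ := by linarith
  have h2 : HasDerivAt (fun t : ℝ => 2 * t) 2 θ := by
    simpa using (hasDerivAt_id θ).const_mul 2
  have hyd : HasDerivAt (fun t : ℝ => v - A * t) (-A) θ := by
    simpa using ((hasDerivAt_id θ).const_mul A).const_sub v
  have hyl : HasDerivAt (fun t : ℝ => Real.log (4 * (v - A * t) / B)) _ θ :=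
    ((hyd.const_mul 4).div_const B).log (by positivity)
  have hsl : HasDerivAt (fun t : ℝ => Real.log (Real.sin (2 * t))) _ θ := h2.sin.log hs.ne'
  have hq := (hyd.mul h2.cos).div h2.sin hs.ne'
  have := (((hyl.sub hsl).const_mul (A / 2)).add hq).sub_const (B / 4)
  refine this.congr_deriv ?_
  simp only [Pi.mul_apply]
  field_simp
  ring

lemma convex_angles (A v : ℝ) : Convex ℝ (Ioo 0 (π / 2) ∩ {θ | A * θ < v}) :=
  (convex_Ioo _ _).inter
    (convex_halfSpace_lt (IsLinearMap.mk (fun x y => mul_add A x y)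
      (fun c x => by simp only [smul_eq_mul]; ring)) v)

lemma levelRe_strictAntiOn {A B v : ℝ} (hB : 0 < B) :
    StrictAntiOn (levelRe A B v) (Ioo 0 (π / 2) ∩ {θ | A * θ < v}) := by
  refine strictAntiOn_of_deriv_neg (convex_angles A v)
    (fun θ h => (hasDerivAt_levelRe hB h.1.1 h.1.2 h.2).continuousAt.continuousWithinAt) ?_
  intro θ h
  obtain ⟨⟨h0, h1⟩, hlt⟩ := interior_subset h
  rw [(hasDerivAt_levelRe hB h0 h1 hlt).deriv]
  have hy : 0 < v - A * θ := sub_pos.2 hlt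
  exact div_neg_of_neg_of_pos (by
    nlinarith [sq_nonneg (A + 2 * (v - A * θ) * Real.cos (2 * θ) / Real.sin (2 * θ)),
      pow_pos hy 2]) (by positivity)

lemma levelRe_eq_inv_mul {A B v θ : ℝ} (hs : Real.sin (2 * θ) ≠ 0) :
    levelRe A B v θ = (Real.sin (2 * θ))⁻¹ * ((v - A * θ) * Real.cos (2 * θ)
        - A / 2 * (Real.sin (2 * θ) * Real.log (Real.sin (2 * θ))))
      + (A / 2 * Real.log (4 * (v - A * θ) / B) - B / 4) := by
  rw [levelRe]
  field_simp
  ring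

lemma tendsto_levelRe_aux {A B v a : ℝ} {l : Filter ℝ} (hl : l ≤ 𝓝 a)
    (hB : 0 < B) (ha : 0 < v - A * a) (hsa : Real.sin (2 * a) = 0) :
    Filter.Tendsto (fun θ => (v - A * θ) * Real.cos (2 * θ)
        - A / 2 * (Real.sin (2 * θ) * Real.log (Real.sin (2 * θ)))) l
        (𝓝 ((v - A * a) * Real.cos (2 * a))) ∧
    Filter.Tendsto (fun θ => A / 2 * Real.log (4 * (v - A * θ) / B) - B / 4) l
        (𝓝 (A / 2 * Real.log (4 * (v - A * a) / B) - B / 4)) := by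
  constructor
  · have hc : Continuous (fun θ => (v - A * θ) * Real.cos (2 * θ)
        - A / 2 * (Real.sin (2 * θ) * Real.log (Real.sin (2 * θ)))) := by
      have : Continuous fun θ : ℝ => Real.sin (2 * θ) * Real.log (Real.sin (2 * θ)) :=
        Real.continuous_mul_log.comp (by fun_prop : Continuous fun θ : ℝ => Real.sin (2 * θ))
      fun_prop
    have := (hc.tendsto a).mono_left hl
    simpa [hsa] using this
  · have hc : ContinuousAt (fun θ => A / 2 * Real.log (4 * (v - A * θ) / B) - B / 4) a := by
      have : 4 * (v - A * a) / B ≠ 0 := by positivity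
      fun_prop (disch := assumption)
    exact hc.tendsto.mono_left hl

lemma tendsto_sin_two_mul_inv {l : Filter ℝ} {a : ℝ} (hl : l ≤ 𝓝 a)
    (hsa : Real.sin (2 * a) = 0) (hI : ∀ᶠ θ in l, θ ∈ Ioo 0 (π / 2)) :
    Filter.Tendsto (fun θ => (Real.sin (2 * θ))⁻¹) l Filter.atTop := by
  refine Filter.Tendsto.inv_tendsto_nhdsGT_zero (tendsto_nhdsWithin_iff.2 ⟨?_, ?_⟩)
  · have : Continuous fun θ : ℝ => Real.sin (2 * θ) := by fun_prop
    simpa [hsa] using (this.tendsto a).mono_left hl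
  · filter_upwards [hI] with θ hθ using sin_two_mul_pos hθ.1 hθ.2

lemma tendsto_levelRe_zero {A B v : ℝ} (hB : 0 < B) (hv : 0 < v) :
    Filter.Tendsto (levelRe A B v) (𝓝[>] 0) Filter.atTop := by
  have hI : ∀ᶠ θ in 𝓝[>] (0:ℝ), θ ∈ Ioo 0 (π / 2) := Ioo_mem_nhdsGT (by positivity)
  have hl : 𝓝[>] (0:ℝ) ≤ 𝓝 0 := nhdsWithin_le_nhds
  obtain ⟨h1, h2⟩ := tendsto_levelRe_aux (A := A) (v := v) hl hB (by simpa using hv) (by simp)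
  have h3 := tendsto_sin_two_mul_inv hl (by simp) hI
  refine ((h3.atTop_mul_pos (by simpa using hv) h1).atTop_add h2).congr' ?_
  filter_upwards [hI] with θ hθ
  exact (levelRe_eq_inv_mul (sin_two_mul_pos hθ.1 hθ.2).ne').symm

lemma tendsto_levelRe_pi_div_two {A B v : ℝ} (hB : 0 < B) (hv : A * (π / 2) < v) :
    Filter.Tendsto (levelRe A B v) (𝓝[<] (π / 2)) Filter.atBot := by
  have hI : ∀ᶠ θ in 𝓝[<] (π / 2), θ ∈ Ioo 0 (π / 2) := Ioo_mem_nhdsLT (by positivity)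
  have hl : 𝓝[<] (π / 2) ≤ 𝓝 (π / 2) := nhdsWithin_le_nhds
  have hpi : 2 * (π / 2) = π := by ring
  have hs : Real.sin (2 * (π / 2)) = 0 := by rw [hpi, Real.sin_pi]
  obtain ⟨h1, h2⟩ := tendsto_levelRe_aux (A := A) (v := v) hl hB (by linarith) hs
  have h3 := tendsto_sin_two_mul_inv hl hs hI
  refine ((h3.atTop_mul_neg (by rw [hpi, Real.cos_pi]; linarith) h1).atBot_add h2).congr' ?_
  filter_upwards [hI] with θ hθ
  exact (levelRe_eq_inv_mul (sin_two_mul_pos hθ.1 hθ.2).ne').symm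

lemma tendsto_levelRe_of_lt {A B v : ℝ} (hA : 0 < A) (hB : 0 < B) (hv : 0 < v)
    (hv' : v < A * (π / 2)) :
    Filter.Tendsto (levelRe A B v) (𝓝[<] (v / A)) Filter.atBot := by
  have hl : 𝓝[<] (v / A) ≤ 𝓝 (v / A) := nhdsWithin_le_nhds
  have hs : Real.sin (2 * (v / A)) ≠ 0 :=
    (sin_two_mul_pos (by positivity) (by rw [div_lt_iff₀ hA]; linarith)).ne'
  have hc : ContinuousAt (fun θ => -(A / 2 * Real.log (Real.sin (2 * θ))) +
      (v - A * θ) * Real.cos (2 * θ) / Real.sin (2 * θ) - B / 4) (v / A) := by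
    fun_prop (disch := assumption)
  have hy : Filter.Tendsto (fun θ => 4 * (v - A * θ) / B) (𝓝[<] (v / A)) (𝓝[>] 0) := by
    refine tendsto_nhdsWithin_iff.2 ⟨?_, ?_⟩
    · have : Continuous fun θ : ℝ => 4 * (v - A * θ) / B := by fun_prop
      have h := (this.tendsto (v / A)).mono_left hl
      rwa [mul_div_cancel₀ _ hA.ne', sub_self, mul_zero, zero_div] at h
    · filter_upwards [self_mem_nhdsWithin] with θ hθ
      have : θ * A < v := (lt_div_iff₀ hA).1 hθ
      have : 0 < v - A * θ := by linarith
      simp only [mem_Ioi]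
      positivity
  have := ((Real.tendsto_log_nhdsGT_zero.comp hy).const_mul_atBot (half_pos hA)).atBot_add
    (hc.tendsto.mono_left hl)
  refine this.congr fun θ => ?_
  simp only [levelRe, Function.comp]
  ring

lemma tendsto_levelRe_of_eq {A B : ℝ} (hA : 0 < A) (hB : 0 < B) :
    Filter.Tendsto (levelRe A B (A * π / 2)) (𝓝[<] (π / 2))
      (𝓝 (A / 2 * Real.log (2 * A / B) - (2 * A + B) / 4)) := by
  have hI : ∀ᶠ θ in 𝓝[<] (π / 2), θ ∈ Ioo 0 (π / 2) := Ioo_mem_nhdsLT (by positivity)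
  have hder : HasDerivAt (fun t : ℝ => Real.sin (2 * t)) (-2) (π / 2) := by
    have h2 : HasDerivAt (fun t : ℝ => 2 * t) 2 (π / 2) := by
      simpa using (hasDerivAt_id (π / 2)).const_mul 2
    refine h2.sin.congr_deriv ?_
    rw [show 2 * (π / 2) = π by ring, Real.cos_pi]
    ring
  have hq : Filter.Tendsto (fun θ => (π / 2 - θ) / Real.sin (2 * θ)) (𝓝[<] (π / 2))
      (𝓝 (1 / 2)) := by
    have h := (hasDerivAt_iff_tendsto_slope.1 hder).mono_left
      (nhdsWithin_mono _ (fun x (hx : x < π / 2) => hx.ne))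
    have h' := (h.inv₀ (by norm_num)).neg
    rw [show -(-2 : ℝ)⁻¹ = 1 / 2 by norm_num] at h'
    refine h'.congr fun θ => ?_
    rw [slope_def_field, show 2 * (π / 2) = π by ring, Real.sin_pi, inv_div, sub_zero,
      ← neg_div, neg_sub]
  have hc : Filter.Tendsto (fun θ : ℝ => Real.cos (2 * θ)) (𝓝[<] (π / 2)) (𝓝 (-1)) := by
    have : Continuous fun θ : ℝ => Real.cos (2 * θ) := by fun_prop
    have h := (this.tendsto (π / 2)).mono_left (nhdsWithin_le_nhds (s := Iio (π / 2)))
    rwa [show 2 * (π / 2) = π by ring, Real.cos_pi] at h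
  have hlog := ((hq.const_mul (4 * A / B)).log (by positivity)).const_mul (A / 2)
  have := ((hlog.add ((hq.mul hc).const_mul A))).sub_const (B / 4)
  rw [show 4 * A / B * (1 / 2) = 2 * A / B by ring] at this
  convert this.congr' ?_ using 2
  · ring
  · filter_upwards [hI] with θ hθ
    have hs := sin_two_mul_pos hθ.1 hθ.2
    have hd : 0 < π / 2 - θ := sub_pos.2 hθ.2
    rw [levelRe, show A * π / 2 - A * θ = A * (π / 2 - θ) by ring,
      ← Real.log_div (by positivity) hs.ne',
      show 4 * A / B * ((π / 2 - θ) / Real.sin (2 * θ))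
        = 4 * (A * (π / 2 - θ)) / B / Real.sin (2 * θ) by ring]
    ring

lemma exists_levelRe_eq {A B u v θ₁ θ₂ : ℝ} (hB : 0 < B)
    (h₁ : θ₁ ∈ Ioo 0 (π / 2) ∩ {θ | A * θ < v}) (h₂ : θ₂ ∈ Ioo 0 (π / 2) ∩ {θ | A * θ < v})
    (hu₁ : levelRe A B v θ₁ ≤ u) (hu₂ : u ≤ levelRe A B v θ₂) :
    ∃ θ ∈ Ioo 0 (π / 2) ∩ {θ | A * θ < v}, levelRe A B v θ = u := by
  exact (convex_angles A v).isPreconnected.intermediate_value h₁ h₂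
    (fun θ h => (hasDerivAt_levelRe hB h.1.1 h.1.2 h.2).continuousAt.continuousWithinAt)
    ⟨hu₁, hu₂⟩

lemma exists_levelRe_ge {A B v : ℝ} (hA : 0 < A) (hB : 0 < B) (hv : 0 < v) (u : ℝ) :
    ∃ θ ∈ Ioo 0 (π / 2) ∩ {θ | A * θ < v}, u ≤ levelRe A B v θ := by
  have hI : ∀ᶠ θ in 𝓝[>] (0:ℝ), θ ∈ Ioo 0 (π / 2) := Ioo_mem_nhdsGT (by positivity)
  have hJ : ∀ᶠ θ in 𝓝[>] (0:ℝ), θ ∈ Ioo 0 (v / A) := Ioo_mem_nhdsGT (by positivity)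
  obtain ⟨θ, h1, h2, h3⟩ :=
    (hI.and (hJ.and ((tendsto_levelRe_zero hB hv).eventually_ge_atTop u))).exists
  exact ⟨θ, ⟨h1, by simpa [mul_comm] using (lt_div_iff₀ hA).1 h2.2⟩, h3⟩

lemma exists_levelRe_le {A B u v : ℝ} (hA : 0 < A) (hB : 0 < B) (hv : 0 < v)
    (h : v = A * π / 2 → A / 2 * Real.log (2 * A / B) - (2 * A + B) / 4 < u) :
    ∃ θ ∈ Ioo 0 (π / 2) ∩ {θ | A * θ < v}, levelRe A B v θ ≤ u := by
  have hI : ∀ᶠ θ in 𝓝[<] (π / 2), θ ∈ Ioo 0 (π / 2) := Ioo_mem_nhdsLT (by positivity)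
  rcases lt_trichotomy v (A * (π / 2)) with hlt | heq | hgt
  · have hJ : ∀ᶠ θ in 𝓝[<] (v / A), θ ∈ Ioo 0 (v / A) := Ioo_mem_nhdsLT (by positivity)
    obtain ⟨θ, h2, h3⟩ :=
      (hJ.and ((tendsto_levelRe_of_lt hA hB hv hlt).eventually_le_atBot u)).exists
    have h4 : v / A < π / 2 := by rw [div_lt_iff₀ hA]; linarith
    exact ⟨θ, ⟨⟨h2.1, h2.2.trans h4⟩, by simpa [mul_comm] using (lt_div_iff₀ hA).1 h2.2⟩, h3⟩
  · obtain rfl : v = A * π / 2 := by rw [heq]; ring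
    obtain ⟨θ, h2, h3⟩ :=
      (hI.and ((tendsto_levelRe_of_eq hA hB).eventually_le_const (h rfl))).exists
    exact ⟨θ, ⟨h2, by simp only [mem_ofPred_eq]; nlinarith [h2.2]⟩, h3⟩
  · obtain ⟨θ, h2, h3⟩ :=
      (hI.and ((tendsto_levelRe_pi_div_two hB hgt).eventually_le_atBot u)).exists
    exact ⟨θ, ⟨h2, by simp only [mem_ofPred_eq]; nlinarith [h2.2]⟩, h3⟩

lemma lt_levelRe {A B θ : ℝ} (hA : 0 < A) (hB : 0 < B) (hθ : θ ∈ Ioo 0 (π / 2)) :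
    A / 2 * Real.log (2 * A / B) - (2 * A + B) / 4 < levelRe A B (A * π / 2) θ := by
  have hmem : ∀ t ∈ Ioo 0 (π / 2), t ∈ Ioo 0 (π / 2) ∩ {θ | A * θ < A * π / 2} :=
    fun t ht => ⟨ht, by simp only [mem_ofPred_eq]; nlinarith [ht.2]⟩
  obtain ⟨t, ht, ht'⟩ := exists_between hθ.2
  have htI : t ∈ Ioo 0 (π / 2) := ⟨hθ.1.trans ht, ht'⟩
  refine lt_of_le_of_lt ?_ (levelRe_strictAntiOn hB (hmem θ hθ) (hmem t htI) ht)
  refine le_of_tendsto (tendsto_levelRe_of_eq hA hB) ?_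
  filter_upwards [Ioo_mem_nhdsLT ht'] with x hx
  exact (levelRe_strictAntiOn hB (hmem t htI) (hmem x ⟨htI.1.trans hx.1, hx.2⟩) hx.1).le

lemma polar_inj_of_pos {A B r r' θ θ' : ℝ} (hB : 0 < B) (hr : 0 < r)
    (hr' : 0 < r') (h0 : 0 < θ) (h1 : θ < π / 2) (h0' : 0 < θ') (h1' : θ' < π / 2)
    (hre : polarRe A B r θ = polarRe A B r' θ') (him : polarIm A B r θ = polarIm A B r' θ') :
    r = r' ∧ θ = θ' := by
  have hθ : θ = θ' := by
    refine (levelRe_strictAntiOn (v := polarIm A B r θ) hB).injOn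
      ⟨⟨h0, h1⟩, lt_of_polarIm_eq hB hr h0 h1 rfl⟩
      ⟨⟨h0', h1'⟩, lt_of_polarIm_eq hB hr' h0' h1' him.symm⟩ ?_
    rw [← polarRe_eq_levelRe hB hr h0 h1 rfl, ← polarRe_eq_levelRe hB hr' h0' h1' him.symm, hre]
  subst hθ
  refine ⟨?_, rfl⟩
  rw [← sq_eq_sq₀ hr.le hr'.le, sq_eq_of_polarIm_eq hB h0 h1 rfl,
    sq_eq_of_polarIm_eq hB h0 h1 him.symm]

lemma polarRe_zero_strictMonoOn {A B : ℝ} (hA : 0 < A) (hB : 0 < B) :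
    StrictMonoOn (fun r => polarRe A B r 0) (Ioi 0) := by
  intro r hr r' _ h
  have h1 := Real.log_lt_log hr h
  have h2 : r ^ 2 < r' ^ 2 := pow_lt_pow_left₀ h (le_of_lt hr) two_ne_zero
  simp only [polarRe, mul_zero, Real.cos_zero, mul_one]
  gcongr

lemma polar_inj {A B r r' θ θ' : ℝ} (hA : 0 < A) (hB : 0 < B) (hr : 0 < r)
    (hr' : 0 < r') (hθ : θ ∈ Ioo (-(π / 2)) (π / 2)) (hθ' : θ' ∈ Ioo (-(π / 2)) (π / 2))
    (hre : polarRe A B r θ = polarRe A B r' θ') (him : polarIm A B r θ = polarIm A B r' θ') :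
    r = r' ∧ θ = θ' := by
  have hneg : ∀ {r θ : ℝ}, θ ∈ Ioo (-(π / 2)) (π / 2) → θ < 0 → polarIm A B r θ < 0 := by
    intro r θ h h0
    have := polarIm_pos (r := r) hA hB (neg_pos.2 h0) (by linarith [h.1])
    rw [polarIm_neg] at this
    linarith
  have hpos : ∀ {r θ : ℝ}, θ ∈ Ioo (-(π / 2)) (π / 2) → 0 < θ → 0 < polarIm A B r θ :=
    fun h h0 => polarIm_pos hA hB h0 h.2
  have hzero : ∀ r : ℝ, polarIm A B r 0 = 0 := fun r => by simp [polarIm]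
  rcases lt_trichotomy θ 0 with h | rfl | h <;> rcases lt_trichotomy θ' 0 with h' | rfl | h'
  · have := polar_inj_of_pos hB hr hr' (neg_pos.2 h) (by linarith [hθ.1]) (neg_pos.2 h')
      (by linarith [hθ'.1]) (by simpa only [polarRe_neg] using hre)
      (by simpa only [polarIm_neg, neg_inj] using him)
    exact ⟨this.1, neg_inj.1 this.2⟩
  · linarith [hneg (r := r) hθ h, hzero r']
  · linarith [hneg (r := r) hθ h, hpos (r := r') hθ' h']
  · linarith [hneg (r := r') hθ' h', hzero r]
  · exact ⟨(polarRe_zero_strictMonoOn hA hB).injOn hr hr' hre, rfl⟩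
  · linarith [hpos (r := r') hθ' h', hzero r]
  · linarith [hneg (r := r') hθ' h', hpos (r := r) hθ h]
  · linarith [hpos (r := r) hθ h, hzero r']
  · exact polar_inj_of_pos hB hr hr' h hθ.2 h' hθ'.2 hre him

lemma exists_polarRe_zero {A B : ℝ} (hA : 0 < A) (hB : 0 < B) (u : ℝ) :
    ∃ r > 0, polarRe A B r 0 = u := by
  have hfun : (fun t => polarRe A B (Real.exp t) 0)
      = fun t => A * t + B / 4 * (Real.exp t ^ 2 - 1) := by
    funext t
    simp [polarRe]
  have hcont : Continuous fun t => polarRe A B (Real.exp t) 0 := by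
    rw [hfun]
    fun_prop
  have htop : Filter.Tendsto (fun t => polarRe A B (Real.exp t) 0) Filter.atTop Filter.atTop := by
    refine Filter.tendsto_atTop_mono (f := fun t => A * t + -(B / 4)) (fun t => ?_)
      (Filter.tendsto_atTop_add_const_right _ _ (Filter.tendsto_id.const_mul_atTop hA))
    rw [congrFun hfun t]
    nlinarith [mul_pos hB (pow_pos (Real.exp_pos t) 2)]
  have hbot : Filter.Tendsto (fun t => polarRe A B (Real.exp t) 0) Filter.atBot Filter.atBot := by
    rw [hfun]
    refine (Filter.tendsto_id.const_mul_atBot hA).atBot_add (C := B / 4 * (0 ^ 2 - 1)) ?_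
    exact ((Real.tendsto_exp_atBot.pow 2).sub_const 1).const_mul (B / 4)
  obtain ⟨t, ht⟩ := hcont.surjective htop hbot u
  exact ⟨Real.exp t, Real.exp_pos t, ht⟩

lemma exists_polar_iff_of_pos {A B u v : ℝ} (hA : 0 < A) (hB : 0 < B) (hv : 0 < v) :
    (∃ r > 0, ∃ θ ∈ Ioo 0 (π / 2), polarRe A B r θ = u ∧ polarIm A B r θ = v) ↔
      (v = A * π / 2 → A / 2 * Real.log (2 * A / B) - (2 * A + B) / 4 < u) := by
  constructor
  · rintro ⟨r, hr, θ, hθ, rfl, him⟩ rfl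
    rw [polarRe_eq_levelRe hB hr hθ.1 hθ.2 him]
    exact lt_levelRe hA hB hθ
  · intro h
    obtain ⟨θ₁, h₁, hu₁⟩ := exists_levelRe_le hA hB hv h
    obtain ⟨θ₂, h₂, hu₂⟩ := exists_levelRe_ge hA hB hv u
    obtain ⟨θ, hθ, rfl⟩ := exists_levelRe_eq hB h₁ h₂ hu₁ hu₂
    obtain ⟨r, hr, h⟩ := exists_polar_of_levelRe hB hθ.1.1 hθ.1.2 hθ.2
    exact ⟨r, hr, θ, hθ.1, h⟩

lemma exists_polar_iff {A B u v : ℝ} (hA : 0 < A) (hB : 0 < B) :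
    (∃ r > 0, ∃ θ ∈ Ioo (-(π / 2)) (π / 2), polarRe A B r θ = u ∧ polarIm A B r θ = v) ↔
      ¬((v = A * π / 2 ∨ v = -(A * π / 2)) ∧
        u ≤ A / 2 * Real.log (2 * A / B) - (2 * A + B) / 4) := by
  have hpi : 0 < A * π / 2 := by positivity
  have hhalf : ∀ {v : ℝ}, 0 < v →
      ((∃ r > 0, ∃ θ ∈ Ioo (-(π / 2)) (π / 2), polarRe A B r θ = u ∧ polarIm A B r θ = v) ↔
        (v = A * π / 2 → A / 2 * Real.log (2 * A / B) - (2 * A + B) / 4 < u)) := by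
    intro v hv
    rw [← exists_polar_iff_of_pos hA hB hv]
    constructor
    · rintro ⟨r, hr, θ, hθ, hre, him⟩
      refine ⟨r, hr, θ, ⟨?_, hθ.2⟩, hre, him⟩
      by_contra! hneg
      have hnn : 0 ≤ Real.sin (2 * -θ) :=
        Real.sin_nonneg_of_nonneg_of_le_pi (by linarith) (by linarith [hθ.1])
      have : 0 ≤ polarIm A B r (-θ) :=
        add_nonneg (mul_nonneg hA.le (by linarith)) (by positivity)
      rw [polarIm_neg] at this
      linarith
    · rintro ⟨r, hr, θ, hθ, h⟩
      exact ⟨r, hr, θ, ⟨by linarith [hθ.1, Real.pi_pos], hθ.2⟩, h⟩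
  rcases lt_trichotomy v 0 with hv | rfl | hv
  · have hne : v ≠ A * π / 2 := by linarith
    have hflip : (∃ r > 0, ∃ θ ∈ Ioo (-(π / 2)) (π / 2),
          polarRe A B r θ = u ∧ polarIm A B r θ = v) ↔
        ∃ r > 0, ∃ θ ∈ Ioo (-(π / 2)) (π / 2), polarRe A B r θ = u ∧ polarIm A B r θ = -v := by
      constructor <;> rintro ⟨r, hr, θ, hθ, hre, him⟩ <;>
        refine ⟨r, hr, -θ, ⟨by linarith [hθ.2], by linarith [hθ.1]⟩, by rwa [polarRe_neg], ?_⟩ <;>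
        rw [polarIm_neg, him]
      exact neg_neg v
    rw [hflip, hhalf (neg_pos.2 hv), neg_eq_iff_eq_neg]
    simp [hne]
  · have h1 : (0 : ℝ) ≠ A * π / 2 := hpi.ne
    have h2 : (0 : ℝ) ≠ -(A * π / 2) := by linarith
    simp only [h1, h2, or_self, false_and, not_false_eq_true, iff_true]
    obtain ⟨r, hr, h⟩ := exists_polarRe_zero hA hB u
    exact ⟨r, hr, 0, ⟨by linarith [Real.pi_pos], by positivity⟩, h, by simp [polarIm]⟩
  · have hne : v ≠ -(A * π / 2) := by linarith
    rw [hhalf hv]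
    simp [hne]

lemma mul_log_add_mul_sq_re_im (A B : ℝ) (w : ℂ) :
    ((A : ℂ) * Complex.log w + (B : ℂ) / 4 * (w ^ 2 - 1)).re = polarRe A B ‖w‖ w.arg ∧
    ((A : ℂ) * Complex.log w + (B : ℂ) / 4 * (w ^ 2 - 1)).im = polarIm A B ‖w‖ w.arg := by
  have hre := Complex.norm_mul_cos_arg w
  have him := Complex.norm_mul_sin_arg w
  have hB : (B : ℂ) / 4 = ((B / 4 : ℝ) : ℂ) := by push_cast; rfl
  have hcos : ‖w‖ ^ 2 * Real.cos (2 * w.arg) = w.re ^ 2 - w.im ^ 2 := by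
    rw [Real.cos_two_mul', ← hre, ← him]
    ring
  have hsin : ‖w‖ ^ 2 * Real.sin (2 * w.arg) = 2 * w.re * w.im := by
    rw [Real.sin_two_mul, ← hre, ← him]
    ring
  rw [polarRe, polarIm, hcos, hsin, hB]
  constructor
  · simp [Complex.log_re, pow_two]
  · simp [Complex.log_im, pow_two]
    exact Or.inl (by ring)

lemma norm_lt_one_of_re_pos {w : ℂ} (hw : 0 < w.re) : ‖(w - 1) / (w + 1)‖ < 1 := by
  have h1 : w + 1 ≠ 0 := fun h => by
    have := congrArg Complex.re h
    simp at this
    linarith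
  rw [norm_div, div_lt_one (norm_pos_iff.2 h1), ← sq_lt_sq₀ (norm_nonneg _) (norm_nonneg _),
    ← Complex.normSq_eq_norm_sq, ← Complex.normSq_eq_norm_sq, Complex.normSq_apply,
    Complex.normSq_apply]
  simp
  nlinarith

lemma re_pos_of_norm_lt_one {z : ℂ} (hz : ‖z‖ < 1) : 0 < ((1 + z) / (1 - z)).re := by
  have h1 : 1 - z ≠ 0 := fun h => by
    rw [← sub_eq_zero.1 h] at hz
    simp at hz
  have h2 : Complex.normSq z < 1 := by
    rw [Complex.normSq_eq_norm_sq]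
    nlinarith [norm_nonneg z]
  have h3 := Complex.normSq_pos.2 h1
  rw [Complex.div_re, ← add_div]
  refine div_pos ?_ h3
  rw [Complex.normSq_apply] at h2
  simp
  nlinarith

theorem slit_mapping_image_c_neg_two
    (A B : ℝ) (hA : 0 < A) (hB : 0 < B) :
    let φ : ℂ → ℂ := fun z =>
      (A : ℂ) * Complex.log ((1 + z) / (1 - z)) + (B : ℂ) * z / (1 - z) ^ 2
    Set.InjOn φ unitDisk ∧
    φ '' unitDisk =
      {w : ℂ | (w.im = A * Real.pi / 2 ∨ w.im = -(A * Real.pi / 2)) ∧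
        w.re ≤ A / 2 * Real.log (2 * A / B) - (2 * A + B) / 4}ᶜ := by
  intro φ
  have hne : ∀ z ∈ unitDisk, 1 - z ≠ 0 := fun z hz h => by
    have hz : ‖z‖ < 1 := mem_ball_zero_iff.1 hz
    rw [← sub_eq_zero.1 h] at hz
    simp at hz
  have hφ : ∀ z ∈ unitDisk, φ z = (A : ℂ) * Complex.log ((1 + z) / (1 - z))
      + (B : ℂ) / 4 * (((1 + z) / (1 - z)) ^ 2 - 1) := by
    intro z hz
    have := hne z hz
    simp only [φ]
    congr 1
    field_simp
    ring
  have hpolar : ∀ z ∈ unitDisk, 0 < ‖(1 + z) / (1 - z)‖ ∧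
      ((1 + z) / (1 - z)).arg ∈ Ioo (-(π / 2)) (π / 2) := by
    intro z hz
    have hre := re_pos_of_norm_lt_one (mem_ball_zero_iff.1 hz)
    have h0 : (1 + z) / (1 - z) ≠ 0 := fun h => by simp [h] at hre
    exact ⟨norm_pos_iff.2 h0, abs_lt.1 (Complex.abs_arg_lt_pi_div_two_iff.2 (Or.inl hre))⟩
  constructor
  · intro z hz z' hz' h
    rw [hφ z hz, hφ z' hz'] at h
    have hre := congrArg Complex.re h
    have him := congrArg Complex.im h
    rw [(mul_log_add_mul_sq_re_im A B _).1, (mul_log_add_mul_sq_re_im A B _).1] at hre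
    rw [(mul_log_add_mul_sq_re_im A B _).2, (mul_log_add_mul_sq_re_im A B _).2] at him
    obtain ⟨hr, hθ⟩ := polar_inj hA hB (hpolar z hz).1 (hpolar z' hz').1 (hpolar z hz).2
      (hpolar z' hz').2 hre him
    have hw := Complex.ext_norm_arg hr hθ
    rw [div_eq_div_iff (hne z hz) (hne z' hz')] at hw
    linear_combination hw / 2
  · ext w
    rw [mem_compl_iff, mem_ofPred_eq, ← exists_polar_iff hA hB]
    constructor
    · rintro ⟨z, hz, rfl⟩
      rw [hφ z hz]
      exact ⟨_, (hpolar z hz).1, _, (hpolar z hz).2, (mul_log_add_mul_sq_re_im A B _).1.symm,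
        (mul_log_add_mul_sq_re_im A B _).2.symm⟩
    · rintro ⟨r, hr, θ, hθ, hre, him⟩
      set ζ : ℂ := r * (Complex.cos θ + Complex.sin θ * Complex.I) with hζ
      have harg : ζ.arg = θ := Complex.arg_mul_cos_add_sin_mul_I hr
        ⟨by linarith [hθ.1, Real.pi_pos], by linarith [hθ.2, Real.pi_pos]⟩
      have hnorm : ‖ζ‖ = r := by
        rw [hζ, norm_mul, Complex.norm_cos_add_sin_mul_I, mul_one, Complex.norm_of_nonneg hr.le]
      have hζre : 0 < ζ.re := by
        rw [← Complex.norm_mul_cos_arg, hnorm, harg]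
        exact mul_pos hr (Real.cos_pos_of_mem_Ioo hθ)
      have h1 : ζ + 1 ≠ 0 := fun h => by
        have := congrArg Complex.re h
        rw [Complex.add_re, Complex.one_re, Complex.zero_re] at this
        linarith
      have hz : (ζ - 1) / (ζ + 1) ∈ unitDisk := mem_ball_zero_iff.2 (norm_lt_one_of_re_pos hζre)
      have hback : (1 + (ζ - 1) / (ζ + 1)) / (1 - (ζ - 1) / (ζ + 1)) = ζ := by
        rw [div_eq_iff (hne _ hz)]
        field_simp
        ring
      refine ⟨_, hz, ?_⟩
      rw [hφ _ hz, hback]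
      apply Complex.ext
      · rw [(mul_log_add_mul_sq_re_im A B _).1, hnorm, harg, hre]
      · rw [(mul_log_add_mul_sq_re_im A B _).2, hnorm, harg, him]
end
end

section
/- For real A, B > 0, the function φ(z) = A·Log((1+z)/(1−z)) + B·z/(1+z²) (the case c = 0 of the slit mapping) is injective on 𝔻, and φ(𝔻) is the complex plane minus the four horizontal half-lines { x ± (Aπ/2)i : x ≤ −x₀ } and { x ± (Aπ/2)i : x ≥ x₀ }, where x₀ = (A/2)·log((√(2A+B)+√B)/(√(2A+B)−√B)) + √(B(2A+B))/2. -/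
open Complex Set
open scoped Real

noncomputable section

/-- The map `φ` in the coordinate `s = 2 arctan z`. -/
def stripMap (A B : ℝ) (s : ℂ) : ℂ :=
  (A : ℂ) * Complex.log ((1 + Complex.sin s) / Complex.cos s) + (B : ℂ) / 2 * Complex.sin s

lemma sin_re_eq (s : ℂ) : (Complex.sin s).re = Real.sin s.re * Real.cosh s.im := by
  rw [Complex.sin_eq, ← ofReal_sin, ← ofReal_cos, ← ofReal_sinh, ← ofReal_cosh]
  simp only [add_re, mul_re, mul_im, ofReal_re, ofReal_im, I_re, I_im]
  ring

lemma sin_im_eq (s : ℂ) : (Complex.sin s).im = Real.cos s.re * Real.sinh s.im := by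
  rw [Complex.sin_eq, ← ofReal_sin, ← ofReal_cos, ← ofReal_sinh, ← ofReal_cosh]
  simp only [add_im, mul_re, mul_im, ofReal_re, ofReal_im, I_re, I_im]
  ring

lemma cos_re_eq (s : ℂ) : (Complex.cos s).re = Real.cos s.re * Real.cosh s.im := by
  rw [Complex.cos_eq, ← ofReal_sin, ← ofReal_cos, ← ofReal_sinh, ← ofReal_cosh]
  simp only [sub_re, mul_re, mul_im, ofReal_re, ofReal_im, I_re, I_im]
  ring

lemma cos_im_eq (s : ℂ) : (Complex.cos s).im = -(Real.sin s.re * Real.sinh s.im) := by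
  rw [Complex.cos_eq, ← ofReal_sin, ← ofReal_cos, ← ofReal_sinh, ← ofReal_cosh]
  simp only [sub_im, mul_re, mul_im, ofReal_re, ofReal_im, I_re, I_im]
  ring

lemma normSq_cos_eq (s : ℂ) : normSq (Complex.cos s) =
    (Real.cosh s.im + Real.sin s.re) * (Real.cosh s.im - Real.sin s.re) := by
  rw [normSq_apply, cos_re_eq, cos_im_eq]
  linear_combination Real.cosh s.im ^ 2 * Real.sin_sq_add_cos_sq s.re
    - Real.sin s.re ^ 2 * Real.cosh_sq_sub_sinh_sq s.im

lemma cosh_add_sin_pos {s : ℂ} (h : Complex.cos s ≠ 0) :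
    0 < Real.cosh s.im + Real.sin s.re := by
  have h1 : 0 ≤ Real.cosh s.im + Real.sin s.re := by
    linarith [Real.one_le_cosh s.im, Real.neg_one_le_sin s.re]
  refine lt_of_le_of_ne h1 fun h2 => h ?_
  rw [← normSq_eq_zero, normSq_cos_eq, ← h2, zero_mul]

lemma cosh_sub_sin_pos {s : ℂ} (h : Complex.cos s ≠ 0) :
    0 < Real.cosh s.im - Real.sin s.re := by
  have h1 : 0 ≤ Real.cosh s.im - Real.sin s.re := by
    linarith [Real.one_le_cosh s.im, Real.sin_le_one s.re]
  refine lt_of_le_of_ne h1 fun h2 => h ?_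
  rw [← normSq_eq_zero, normSq_cos_eq, ← h2, mul_zero]

lemma one_add_sin_div_cos {s : ℂ} (h : Complex.cos s ≠ 0) :
    (1 + Complex.sin s) / Complex.cos s =
      ((Real.cos s.re / (Real.cosh s.im - Real.sin s.re) : ℝ) : ℂ) +
        ((Real.sinh s.im / (Real.cosh s.im - Real.sin s.re) : ℝ) : ℂ) * I := by
  have h1 := (cosh_sub_sin_pos h).ne'
  rw [div_eq_iff h]
  apply Complex.ext
  · simp only [add_re, one_re, sin_re_eq, mul_re, ofReal_re, ofReal_im, I_re, I_im, add_im,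
      mul_im, cos_re_eq, cos_im_eq]
    field_simp
    linear_combination -Real.cosh s.im * Real.sin_sq_add_cos_sq s.re
      + Real.sin s.re * Real.cosh_sq_sub_sinh_sq s.im
  · simp only [add_re, one_im, sin_im_eq, mul_re, ofReal_re, ofReal_im, I_re, I_im, add_im,
      mul_im, cos_re_eq, cos_im_eq]
    field_simp
    ring

lemma one_add_sin_div_cos_re {s : ℂ} (h : Complex.cos s ≠ 0) :
    ((1 + Complex.sin s) / Complex.cos s).re =
      Real.cos s.re / (Real.cosh s.im - Real.sin s.re) := by
  rw [one_add_sin_div_cos h]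
  simp only [add_re, mul_re, ofReal_re, ofReal_im, I_re, I_im]
  ring

lemma one_add_sin_div_cos_im {s : ℂ} (h : Complex.cos s ≠ 0) :
    ((1 + Complex.sin s) / Complex.cos s).im =
      Real.sinh s.im / (Real.cosh s.im - Real.sin s.re) := by
  rw [one_add_sin_div_cos h]
  simp only [add_im, mul_im, ofReal_re, ofReal_im, I_re, I_im]
  ring

lemma cos_re_nonneg {s : ℂ} (hs : |s.re| ≤ π / 2) : 0 ≤ Real.cos s.re :=
  Real.cos_nonneg_of_mem_Icc (abs_le.1 hs)

lemma cos_re_pos {s : ℂ} (hs : |s.re| < π / 2) : 0 < Real.cos s.re :=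
  Real.cos_pos_of_mem_Ioo (abs_lt.1 hs)

lemma complex_cos_ne_zero {s : ℂ} (hs : |s.re| < π / 2) : Complex.cos s ≠ 0 := fun h => by
  have := cos_re_eq s
  rw [h, zero_re] at this
  exact (mul_pos (cos_re_pos hs) (Real.cosh_pos s.im)).ne this

lemma one_add_sin_div_cos_mem_slitPlane {s : ℂ} (hs : |s.re| ≤ π / 2) (h : Complex.cos s ≠ 0) :
    (1 + Complex.sin s) / Complex.cos s ∈ slitPlane := by
  have h1 := cosh_sub_sin_pos h
  rw [mem_slitPlane_iff, one_add_sin_div_cos_re h, one_add_sin_div_cos_im h]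
  rcases (cos_re_nonneg hs).lt_or_eq with h2 | h2
  · exact Or.inl (div_pos h2 h1)
  · refine Or.inr (div_ne_zero (fun h3 => h ?_) h1.ne')
    apply Complex.ext
    · rw [cos_re_eq, ← h2, zero_mul, zero_re]
    · rw [cos_im_eq, h3, mul_zero, neg_zero, zero_im]

lemma log_one_add_sin_div_cos_re {s : ℂ} (h : Complex.cos s ≠ 0) :
    (Complex.log ((1 + Complex.sin s) / Complex.cos s)).re =
      Real.log ((Real.cosh s.im + Real.sin s.re) / (Real.cosh s.im - Real.sin s.re)) / 2 := by
  have h1 := cosh_sub_sin_pos h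
  have h2 : ‖(1 + Complex.sin s) / Complex.cos s‖ ^ 2 =
      (Real.cosh s.im + Real.sin s.re) / (Real.cosh s.im - Real.sin s.re) := by
    rw [← normSq_eq_norm_sq, normSq_apply, one_add_sin_div_cos_re h, one_add_sin_div_cos_im h]
    field_simp
    linear_combination Real.sin_sq_add_cos_sq s.re - Real.cosh_sq_sub_sinh_sq s.im
  rw [log_re, ← h2, Real.log_pow]
  push_cast; ring

lemma stripMap_re (A B : ℝ) {s : ℂ} (h : Complex.cos s ≠ 0) :
    (stripMap A B s).re = A / 2 *
      Real.log ((Real.cosh s.im + Real.sin s.re) / (Real.cosh s.im - Real.sin s.re)) +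
      B / 2 * (Real.sin s.re * Real.cosh s.im) := by
  have h2 : (B : ℂ) / 2 = ((B / 2 : ℝ) : ℂ) := by push_cast; rfl
  rw [stripMap, h2, add_re, re_ofReal_mul, re_ofReal_mul, log_one_add_sin_div_cos_re h, sin_re_eq]
  ring

lemma stripMap_im (A B : ℝ) (s : ℂ) :
    (stripMap A B s).im = A * ((1 + Complex.sin s) / Complex.cos s).arg +
      B / 2 * (Real.cos s.re * Real.sinh s.im) := by
  have h2 : (B : ℂ) / 2 = ((B / 2 : ℝ) : ℂ) := by push_cast; rfl
  rw [stripMap, h2, add_im, im_ofReal_mul, im_ofReal_mul, sin_im_eq, log_im]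

lemma stripMap_neg (A B : ℝ) {s : ℂ} (hs : |s.re| ≤ π / 2) (h : Complex.cos s ≠ 0) :
    stripMap A B (-s) = -stripMap A B s := by
  have h1 := one_add_sin_div_cos_mem_slitPlane hs h
  have h2 : (1 + Complex.sin (-s)) / Complex.cos (-s) =
      ((1 + Complex.sin s) / Complex.cos s)⁻¹ := by
    have h3 : 1 + Complex.sin s ≠ 0 := fun h3 => by
      rw [h3, zero_div] at h1; exact zero_notMem_slitPlane h1
    rw [Complex.sin_neg, Complex.cos_neg, inv_div, div_eq_div_iff h h3]
    linear_combination -Complex.sin_sq_add_cos_sq s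
  rw [stripMap, stripMap, h2, log_inv _ (mem_slitPlane_iff_arg.1 h1).1, Complex.sin_neg]
  ring

lemma hasStrictDerivAt_stripMap (A B : ℝ) {s : ℂ} (hs : |s.re| ≤ π / 2)
    (h : Complex.cos s ≠ 0) :
    HasStrictDerivAt (stripMap A B) (A / Complex.cos s + B / 2 * Complex.cos s) s := by
  have h1 := one_add_sin_div_cos_mem_slitPlane hs h
  have h3 : 1 + Complex.sin s ≠ 0 := fun h3 => by
    rw [h3, zero_div] at h1; exact zero_notMem_slitPlane h1
  have h4 := ((((Complex.hasStrictDerivAt_sin s).const_add 1).div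
    (Complex.hasStrictDerivAt_cos s) h).clog h1).const_mul (A : ℂ)
  refine (h4.add ((Complex.hasStrictDerivAt_sin s).const_mul ((B : ℂ) / 2))).congr_deriv ?_
  congr 1
  rw [div_eq_mul_inv (A : ℂ)]
  congr 1
  change _ / ((1 + Complex.sin s) / Complex.cos s) = _
  field_simp
  linear_combination (Complex.sin_sq_add_cos_sq s)

lemma stripMap_deriv_re_pos {A B : ℝ} (hA : 0 < A) (hB : 0 < B) {s : ℂ} (hs : |s.re| < π / 2) :
    0 < ((A : ℂ) / Complex.cos s + B / 2 * Complex.cos s).re := by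
  have h := complex_cos_ne_zero hs
  have h1 : 0 < (Complex.cos s).re := by
    rw [cos_re_eq]; exact mul_pos (cos_re_pos hs) (Real.cosh_pos _)
  have h2 : (B : ℂ) / 2 = ((B / 2 : ℝ) : ℂ) := by push_cast; rfl
  rw [h2, div_eq_mul_inv, add_re, re_ofReal_mul, re_ofReal_mul, inv_re]
  have := normSq_pos.2 h
  positivity

/-- Monotonicity of `stripMap` along segments, from an interior to a regular boundary point. -/
lemma stripMap_segment_pos {A B : ℝ} (hA : 0 < A) (hB : 0 < B) {s s₀ : ℂ} (hs : |s.re| < π / 2)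
    (hs₀ : |s₀.re| ≤ π / 2) (h₀ : Complex.cos s₀ ≠ 0) (hne : s ≠ s₀) :
    0 < ((stripMap A B s₀ - stripMap A B s) * (starRingEnd ℂ) (s₀ - s)).re := by
  set d := s₀ - s with hd
  have hd0 : d ≠ 0 := sub_ne_zero.2 hne.symm
  have hre : ∀ t : ℝ, (s + t * d).re = (1 - t) * s.re + t * s₀.re := fun t => by
    rw [add_re, re_ofReal_mul, hd, sub_re]; ring
  have hint : ∀ t ∈ Ico (0 : ℝ) 1, |(s + t * d).re| < π / 2 := by
    intro t ht
    rw [abs_lt] at hs ⊢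
    rw [abs_le] at hs₀
    rw [hre]
    have := ht.1
    have h1t : 0 < 1 - t := sub_pos.2 ht.2
    constructor <;> nlinarith
  have hder : ∀ t ∈ Icc (0 : ℝ) 1, HasDerivAt
      (fun t : ℝ => (stripMap A B (s + t * d) * (starRingEnd ℂ) d).re)
      ((((A : ℂ) / Complex.cos (s + t * d) + B / 2 * Complex.cos (s + t * d)).re) *
        normSq d) t := by
    intro t ht
    have hreg : |(s + t * d).re| ≤ π / 2 ∧ Complex.cos (s + t * d) ≠ 0 := by
      rcases ht.2.lt_or_eq with h | h
      · exact ⟨(hint t ⟨ht.1, h⟩).le, complex_cos_ne_zero (hint t ⟨ht.1, h⟩)⟩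
      · have : s + (t : ℂ) * d = s₀ := by rw [h, hd]; push_cast; ring
        rw [this]; exact ⟨hs₀, h₀⟩
    have h1 := (hasStrictDerivAt_stripMap A B hreg.1 hreg.2).hasDerivAt
    have h2 : HasDerivAt (fun t : ℂ => s + t * d) d (t : ℂ) := by
      simpa using ((hasDerivAt_id (t : ℂ)).mul_const d).const_add s
    have h3 := ((h1.comp (t : ℂ) h2).mul_const ((starRingEnd ℂ) d)).real_of_complex
    refine h3.congr_deriv ?_
    rw [mul_assoc, mul_conj, re_mul_ofReal]
  have hmono := strictMonoOn_of_deriv_pos (convex_Icc (0 : ℝ) 1)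
    (fun t ht => (hder t ht).continuousAt.continuousWithinAt) (fun t ht => by
      rw [interior_Icc] at ht
      rw [(hder t (Ioo_subset_Icc_self ht)).deriv]
      exact mul_pos (stripMap_deriv_re_pos hA hB (hint t (Ioo_subset_Ico_self ht)))
        (normSq_pos.2 hd0))
  have := hmono (left_mem_Icc.2 zero_le_one) (right_mem_Icc.2 zero_le_one) zero_lt_one
  simp only [ofReal_zero, zero_mul, add_zero, ofReal_one, one_mul] at this
  rw [sub_mul, sub_re]
  rw [show s + d = s₀ by rw [hd]; ring] at this
  linarith

lemma stripMap_injOn {A B : ℝ} (hA : 0 < A) (hB : 0 < B) :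
    InjOn (stripMap A B) {s | |s.re| < π / 2} := by
  intro s hs s₀ hs₀ h
  by_contra hne
  have := stripMap_segment_pos hA hB hs (le_of_lt hs₀) (complex_cos_ne_zero hs₀) hne
  rw [h, sub_self, zero_mul, zero_re] at this
  exact lt_irrefl _ this

lemma isOpen_strip : IsOpen {s : ℂ | |s.re| < π / 2} :=
  isOpen_lt (by fun_prop) continuous_const

lemma isOpen_image_stripMap {A B : ℝ} (hA : 0 < A) (hB : 0 < B) :
    IsOpen (stripMap A B '' {s | |s.re| < π / 2}) := by
  rw [isOpen_iff_mem_nhds]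
  rintro _ ⟨s, hs, rfl⟩
  have h : (A : ℂ) / Complex.cos s + B / 2 * Complex.cos s ≠ 0 := fun h => by
    have := stripMap_deriv_re_pos hA hB hs
    rw [h, zero_re] at this
    exact lt_irrefl _ this
  rw [← (hasStrictDerivAt_stripMap A B (le_of_lt hs)
    (complex_cos_ne_zero hs)).map_nhds_eq h]
  exact Filter.image_mem_map (isOpen_strip.mem_nhds hs)

/-- A compact part of the closed strip that contains all interior points where `stripMap`
is bounded. -/
def stripCompact (K : ℝ) : Set ℂ :=
  {s | |s.re| ≤ π / 2 ∧ |Real.sinh s.im| ≤ K ∧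
    Real.cosh s.im + Real.sin s.re ≤ K * (Real.cosh s.im - Real.sin s.re) ∧
    Real.cosh s.im - Real.sin s.re ≤ K * (Real.cosh s.im + Real.sin s.re)}

lemma isCompact_stripCompact (K : ℝ) : IsCompact (stripCompact K) := by
  have hc : Continuous fun s : ℂ => Real.cosh s.im := Real.continuous_cosh.comp continuous_im
  have hs : Continuous fun s : ℂ => Real.sinh s.im := Real.continuous_sinh.comp continuous_im
  apply Metric.isCompact_of_isClosed_isBounded
  · have hsin : Continuous fun s : ℂ => Real.sin s.re := Real.continuous_sin.comp continuous_re
    exact (isClosed_le continuous_re.abs continuous_const).inter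
      ((isClosed_le hs.abs continuous_const).inter
      ((isClosed_le (hc.add hsin) (continuous_const.mul (hc.sub hsin))).inter
      (isClosed_le (hc.sub hsin) (continuous_const.mul (hc.add hsin)))))
  · rw [isBounded_iff_forall_norm_le]
    refine ⟨π / 2 + K, fun s hs => (norm_le_abs_re_add_abs_im s).trans (add_le_add hs.1 ?_)⟩
    refine le_trans ?_ hs.2.1
    rw [Real.abs_sinh]
    exact Real.self_le_sinh_iff.2 (abs_nonneg _)

lemma cos_ne_zero_of_mem_stripCompact {K : ℝ} {s : ℂ} (hs : s ∈ stripCompact K) :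
    Complex.cos s ≠ 0 := by
  intro h
  have h1 := normSq_cos_eq s
  rw [h, map_zero, eq_comm, mul_eq_zero] at h1
  obtain ⟨-, -, h2, h3⟩ := hs
  have := Real.cosh_pos s.im
  rcases h1 with h1 | h1 <;> rw [h1] at h2 h3 <;> linarith

lemma log_le_of_stripMap {A B : ℝ} (hA : 0 < A) (hB : 0 < B) {s : ℂ} (hs : |s.re| < π / 2) :
    A / 2 * |Real.log ((Real.cosh s.im + Real.sin s.re) / (Real.cosh s.im - Real.sin s.re))| ≤
      |(stripMap A B s).re| ∧
    B / 2 * |Real.sin s.re * Real.cosh s.im| ≤ |(stripMap A B s).re| := by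
  have h := complex_cos_ne_zero hs
  have h1 := cosh_sub_sin_pos h
  have h2 := cosh_add_sin_pos h
  have hc := Real.cosh_pos s.im
  rw [stripMap_re A B h]
  rcases le_total 0 (Real.sin s.re) with h3 | h3
  · have h4 : 0 ≤ Real.log
        ((Real.cosh s.im + Real.sin s.re) / (Real.cosh s.im - Real.sin s.re)) :=
      Real.log_nonneg ((one_le_div h1).2 (by linarith))
    have h5 := mul_nonneg h3 hc.le
    rw [abs_of_nonneg h4, abs_of_nonneg h5, abs_of_nonneg (by positivity)]
    constructor
    · have : 0 ≤ B / 2 * (Real.sin s.re * Real.cosh s.im) := by positivity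
      linarith
    · have := mul_nonneg (half_pos hA).le h4
      linarith
  · have h4 : Real.log
        ((Real.cosh s.im + Real.sin s.re) / (Real.cosh s.im - Real.sin s.re)) ≤ 0 :=
      Real.log_nonpos (div_pos h2 h1).le ((div_le_one h1).2 (by linarith))
    have h5 := mul_nonpos_of_nonpos_of_nonneg h3 hc.le
    have h6 := mul_nonpos_of_nonneg_of_nonpos (half_pos hA).le h4
    have h7 := mul_nonpos_of_nonneg_of_nonpos (half_pos hB).le h5
    rw [abs_of_nonpos h4, abs_of_nonpos h5, abs_of_nonpos (by linarith)]
    constructor <;> linarith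

lemma cos_mul_sinh_le_of_stripMap {A B : ℝ} (hA : 0 < A) (hB : 0 < B) {s : ℂ}
    (hs : |s.re| < π / 2) :
    B / 2 * |Real.cos s.re * Real.sinh s.im| ≤ |(stripMap A B s).im| := by
  have h := complex_cos_ne_zero hs
  have h1 := cosh_sub_sin_pos h
  have hc := cos_re_pos hs
  rw [stripMap_im]
  rcases le_total 0 (Real.sinh s.im) with h3 | h3
  · have h4 : 0 ≤ ((1 + Complex.sin s) / Complex.cos s).arg := by
      rw [arg_nonneg_iff, one_add_sin_div_cos_im h]; positivity
    rw [abs_of_nonneg (by positivity), abs_of_nonneg (by positivity)]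
    have : 0 ≤ A * ((1 + Complex.sin s) / Complex.cos s).arg := by positivity
    linarith
  · have h4 : ((1 + Complex.sin s) / Complex.cos s).arg ≤ 0 := by
      rcases h3.lt_or_eq with h3 | h3
      · rw [← not_lt, ← not_le, not_not]
        refine (arg_neg_iff.2 ?_).le
        rw [one_add_sin_div_cos_im h]
        exact div_neg_of_neg_of_pos h3 h1
      · refine (arg_eq_zero_iff.2 ⟨?_, ?_⟩).le
        · rw [one_add_sin_div_cos_re h]; positivity
        · rw [one_add_sin_div_cos_im h, h3, zero_div]
    have h5 := mul_nonpos_of_nonneg_of_nonpos hc.le h3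
    have h6 := mul_nonpos_of_nonneg_of_nonpos hA.le h4
    have h7 := mul_nonpos_of_nonneg_of_nonpos (half_pos hB).le h5
    rw [abs_of_nonpos h5, abs_of_nonpos (by linarith)]
    linarith

lemma exists_mem_stripCompact {A B : ℝ} (hA : 0 < A) (hB : 0 < B) (M : ℝ) :
    ∃ K, ∀ s : ℂ, |s.re| < π / 2 → ‖stripMap A B s‖ < M → s ∈ stripCompact K := by
  refine ⟨max (4 * M / B) (Real.exp (2 * M / A)), fun s hs hM => ?_⟩
  have h := complex_cos_ne_zero hs
  have h1 := cosh_sub_sin_pos h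
  have h2 := cosh_add_sin_pos h
  obtain ⟨h3, h4⟩ := log_le_of_stripMap hA hB hs
  have h5 := cos_mul_sinh_le_of_stripMap hA hB hs
  have hre := (abs_re_le_norm (stripMap A B s)).trans hM.le
  have him := (abs_im_le_norm (stripMap A B s)).trans hM.le
  have hM0 : 0 < M := (norm_nonneg _).trans_lt hM
  have hlog : |Real.log ((Real.cosh s.im + Real.sin s.re) /
      (Real.cosh s.im - Real.sin s.re))| ≤ 2 * M / A := by
    rw [le_div_iff₀ hA]; linarith
  rw [abs_le] at hlog
  refine ⟨hs.le, le_max_of_le_left ?_, ?_, ?_⟩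
  · have h6 : |Real.sin s.re * Real.cosh s.im| ≤ 2 * M / B := by
      rw [le_div_iff₀ hB]; linarith
    have h7 : |Real.cos s.re * Real.sinh s.im| ≤ 2 * M / B := by
      rw [le_div_iff₀ hB]; linarith
    have h8 := sq_le_sq' (abs_le.1 h6).1 (abs_le.1 h6).2
    have h9 := sq_le_sq' (abs_le.1 h7).1 (abs_le.1 h7).2
    refine abs_le_of_sq_le_sq ?_ (by positivity)
    have h10 : Real.sinh s.im ^ 2 = (Real.sin s.re * Real.cosh s.im) ^ 2 +
        (Real.cos s.re * Real.sinh s.im) ^ 2 - Real.sin s.re ^ 2 := by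
      linear_combination -Real.sinh s.im ^ 2 * Real.sin_sq_add_cos_sq s.re
        - Real.sin s.re ^ 2 * Real.cosh_sq_sub_sinh_sq s.im
    rw [h10, show 4 * M / B = 2 * (2 * M / B) by ring]
    nlinarith [sq_nonneg (Real.sin s.re), sq_nonneg (2 * M / B)]
  · rw [← div_le_iff₀ h1]
    exact le_max_of_le_right ((Real.log_le_iff_le_exp (div_pos h2 h1)).1 hlog.2)
  · rw [← div_le_iff₀ h2]
    refine le_max_of_le_right ((Real.log_le_iff_le_exp (div_pos h1 h2)).1 ?_)
    rw [← inv_div, Real.log_inv]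
    linarith [hlog.1]

lemma closure_image_stripMap {A B : ℝ} (hA : 0 < A) (hB : 0 < B) {w : ℂ}
    (hw : w ∈ closure (stripMap A B '' {s | |s.re| < π / 2})) :
    ∃ s : ℂ, |s.re| ≤ π / 2 ∧ Complex.cos s ≠ 0 ∧ stripMap A B s = w := by
  obtain ⟨K, hK⟩ := exists_mem_stripCompact hA hB (‖w‖ + 1)
  have hcont : ContinuousOn (stripMap A B) (stripCompact K) := fun s hs =>
    (hasStrictDerivAt_stripMap A B hs.1
      (cos_ne_zero_of_mem_stripCompact hs)).hasDerivAt.continuousAt.continuousWithinAt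
  have hclosed := ((isCompact_stripCompact K).image_of_continuousOn hcont).isClosed
  have hball : w ∈ Metric.ball (0 : ℂ) (‖w‖ + 1) := by simp
  have h1 := Metric.isOpen_ball.closure_inter ⟨hw, hball⟩
  have h2 : w ∈ stripMap A B '' stripCompact K := by
    refine hclosed.closure_subset_iff.2 ?_ h1
    rintro _ ⟨⟨s, hs, rfl⟩, hb⟩
    exact ⟨s, hK s hs (by simpa using hb), rfl⟩
  obtain ⟨s, hs, rfl⟩ := h2
  exact ⟨s, hs.1, cos_ne_zero_of_mem_stripCompact hs, rfl⟩

/-- The real part of the tips of the slits on the right. -/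
def slitTip (A B : ℝ) : ℝ := A / 2 *
    Real.log ((Real.sqrt (2 * A + B) + Real.sqrt B) / (Real.sqrt (2 * A + B) - Real.sqrt B)) +
  Real.sqrt (B * (2 * A + B)) / 2

lemma slitTip_eq {A B : ℝ} (hB : 0 < B) {c : ℝ} (hc : 1 < c)
    (hc2 : B * c ^ 2 = 2 * A + B) :
    slitTip A B = A / 2 * Real.log ((c + 1) / (c - 1)) + B / 2 * c := by
  have hb := Real.sqrt_pos.2 hB
  have h1 : Real.sqrt (2 * A + B) = Real.sqrt B * c := by
    rw [← hc2, Real.sqrt_mul hB.le, Real.sqrt_sq (by linarith)]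
  have h2 : Real.sqrt (B * (2 * A + B)) = B * c := by
    rw [← hc2, show B * (B * c ^ 2) = (B * c) ^ 2 by ring, Real.sqrt_sq (by positivity)]
  rw [slitTip, h1, h2, show Real.sqrt B * c + Real.sqrt B = Real.sqrt B * (c + 1) by ring,
    show Real.sqrt B * c - Real.sqrt B = Real.sqrt B * (c - 1) by ring,
    mul_div_mul_left _ _ hb.ne']
  ring

lemma slitTip_le {A B : ℝ} (hA : 0 < A) (hB : 0 < B) {c c₀ : ℝ} (hc : 1 < c) (hc₀ : 1 < c₀)
    (hc2 : B * c₀ ^ 2 = 2 * A + B) :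
    slitTip A B ≤ A / 2 * Real.log ((c + 1) / (c - 1)) + B / 2 * c := by
  have h1 : 0 < c - 1 := by linarith
  have h2 : 0 < c₀ - 1 := by linarith
  have h3 : 0 < c + 1 := by linarith
  have h4 : 0 < c₀ + 1 := by linarith
  rw [slitTip_eq hB hc₀ hc2]
  have h5 := Real.one_sub_inv_le_log_of_pos
    (div_pos (div_pos h3 h1) (div_pos h4 h2))
  rw [Real.log_div (div_pos h3 h1).ne' (div_pos h4 h2).ne'] at h5
  have h6 : -(B / A) * (c - c₀) ≤
      1 - ((c + 1) / (c - 1) / ((c₀ + 1) / (c₀ - 1)))⁻¹ := by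
    have hBA : B / A = 2 / ((c₀ + 1) * (c₀ - 1)) := by
      rw [div_eq_div_iff hA.ne' (by positivity)]; linear_combination hc2
    have h7 : 1 - ((c + 1) / (c - 1) / ((c₀ + 1) / (c₀ - 1)))⁻¹ - -(B / A) * (c - c₀) =
        2 * (c - c₀) ^ 2 / ((c₀ + 1) * (c₀ - 1) * (c + 1)) := by
      rw [hBA]; field_simp; ring
    have h8 : 0 ≤ 2 * (c - c₀) ^ 2 / ((c₀ + 1) * (c₀ - 1) * (c + 1)) := by positivity
    linarith
  have h9 := mul_le_mul_of_nonneg_left (h6.trans h5) (half_pos hA).le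
  have h10 : A / 2 * (-(B / A) * (c - c₀)) = - (B / 2 * (c - c₀)) := by
    field_simp
  rw [h10] at h9
  linarith

lemma exists_slitTip_parameter {A B : ℝ} (hA : 0 < A) (hB : 0 < B) :
    ∃ c : ℝ, 1 < c ∧ B * c ^ 2 = 2 * A + B := by
  refine ⟨Real.sqrt ((2 * A + B) / B), ?_, ?_⟩
  · rw [Real.lt_sqrt zero_le_one, one_pow, one_lt_div hB]; linarith
  · rw [Real.sq_sqrt (by positivity)]; field_simp

lemma im_ne_zero_of_re_eq {s : ℂ} (hs : s.re = π / 2) (h : Complex.cos s ≠ 0) : s.im ≠ 0 := by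
  intro h1
  have := normSq_pos.2 h
  rw [normSq_cos_eq, hs, h1] at this
  simp at this

lemma cos_ne_zero_of_re_eq {s : ℂ} (hs : s.re = π / 2) (h : s.im ≠ 0) : Complex.cos s ≠ 0 := by
  have h1 := Real.one_lt_cosh.2 h
  rw [← normSq_pos, normSq_cos_eq, hs, Real.sin_pi_div_two]
  exact mul_pos (by linarith) (by linarith)

lemma stripMap_boundary_re (A B : ℝ) {s : ℂ} (hs : s.re = π / 2) (h : Complex.cos s ≠ 0) :
    (stripMap A B s).re = A / 2 * Real.log ((Real.cosh s.im + 1) / (Real.cosh s.im - 1)) +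
      B / 2 * Real.cosh s.im := by
  rw [stripMap_re A B h, hs, Real.sin_pi_div_two, one_mul]

lemma stripMap_boundary_im_of_pos (A B : ℝ) {s : ℂ} (hs : s.re = π / 2) (h : 0 < s.im) :
    (stripMap A B s).im = A * π / 2 := by
  have h1 := cos_ne_zero_of_re_eq hs h.ne'
  have h2 : ((1 + Complex.sin s) / Complex.cos s).arg = π / 2 := by
    rw [arg_eq_pi_div_two_iff, one_add_sin_div_cos_re h1, one_add_sin_div_cos_im h1]
    exact ⟨by rw [hs, Real.cos_pi_div_two, zero_div],
      div_pos (Real.sinh_pos_iff.2 h) (cosh_sub_sin_pos h1)⟩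
  rw [stripMap_im, h2, hs, Real.cos_pi_div_two]; ring

lemma stripMap_boundary_im_of_neg (A B : ℝ) {s : ℂ} (hs : s.re = π / 2) (h : s.im < 0) :
    (stripMap A B s).im = -(A * π / 2) := by
  have h1 := cos_ne_zero_of_re_eq hs h.ne
  have h2 : ((1 + Complex.sin s) / Complex.cos s).arg = -(π / 2) := by
    rw [arg_eq_neg_pi_div_two_iff, one_add_sin_div_cos_re h1, one_add_sin_div_cos_im h1]
    exact ⟨by rw [hs, Real.cos_pi_div_two, zero_div],
      div_neg_of_neg_of_pos (Real.sinh_neg_iff.2 h) (cosh_sub_sin_pos h1)⟩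
  rw [stripMap_im, h2, hs, Real.cos_pi_div_two]; ring

lemma stripMap_boundary {A B : ℝ} (hA : 0 < A) (hB : 0 < B) {s : ℂ} (hs : s.re = π / 2)
    (h : Complex.cos s ≠ 0) :
    ((stripMap A B s).im = A * π / 2 ∨ (stripMap A B s).im = -(A * π / 2)) ∧
      slitTip A B ≤ (stripMap A B s).re := by
  have h0 := im_ne_zero_of_re_eq hs h
  obtain ⟨c₀, hc₀, hc2⟩ := exists_slitTip_parameter hA hB
  refine ⟨?_, ?_⟩
  · rcases h0.lt_or_gt with h1 | h1
    · exact Or.inr (stripMap_boundary_im_of_neg A B hs h1)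
    · exact Or.inl (stripMap_boundary_im_of_pos A B hs h1)
  · rw [stripMap_boundary_re A B hs h]
    exact slitTip_le hA hB (Real.one_lt_cosh.2 h0) hc₀ hc2

/-- The tips of the slits on the right are boundary values of `stripMap`. -/
lemma exists_stripMap_eq_slitTip {A B : ℝ} (hA : 0 < A) (hB : 0 < B) {t : ℝ}
    (ht : t = A * π / 2 ∨ t = -(A * π / 2)) :
    ∃ s : ℂ, s.re = π / 2 ∧ Complex.cos s ≠ 0 ∧
      (stripMap A B s).re = slitTip A B ∧ (stripMap A B s).im = t := by
  obtain ⟨c₀, hc₀, hc2⟩ := exists_slitTip_parameter hA hB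
  obtain ⟨y, hy, hyc⟩ := Real.cosh_surjOn (mem_Ici.2 hc₀.le)
  have hy0 : 0 < y := by
    refine lt_of_le_of_ne hy fun h => ?_
    rw [← h, Real.cosh_zero] at hyc
    exact hc₀.ne hyc
  rcases ht with rfl | rfl
  · have h := cos_ne_zero_of_re_eq (s := ⟨π / 2, y⟩) rfl hy0.ne'
    exact ⟨⟨π / 2, y⟩, rfl, h,
      by rw [stripMap_boundary_re A B rfl h, slitTip_eq hB hc₀ hc2, hyc],
      stripMap_boundary_im_of_pos A B rfl hy0⟩
  · have hy1 : -y < 0 := neg_neg_of_pos hy0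
    have h := cos_ne_zero_of_re_eq (s := ⟨π / 2, -y⟩) rfl hy1.ne
    exact ⟨⟨π / 2, -y⟩, rfl, h,
      by rw [stripMap_boundary_re A B rfl h, slitTip_eq hB hc₀ hc2, Real.cosh_neg, hyc],
      stripMap_boundary_im_of_neg A B rfl hy1⟩

lemma stripMap_re_lt_slitTip {A B : ℝ} (hA : 0 < A) (hB : 0 < B) {s : ℂ} (hs : |s.re| < π / 2)
    (h : (stripMap A B s).im = A * π / 2 ∨ (stripMap A B s).im = -(A * π / 2)) :
    (stripMap A B s).re < slitTip A B := by
  obtain ⟨s₀, h1, h2, h3, h4⟩ := exists_stripMap_eq_slitTip hA hB h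
  have hlt : s.re < s₀.re := h1 ▸ (abs_lt.1 hs).2
  have h5 := stripMap_segment_pos hA hB hs
    (by rw [h1, abs_of_pos Real.pi_div_two_pos]) h2 (fun h => hlt.ne (congrArg re h))
  rw [mul_re, sub_im, h4, sub_self, zero_mul, sub_zero, sub_re, h3, conj_re, sub_re] at h5
  exact sub_pos.1 (pos_of_mul_pos_left h5 (sub_pos.2 hlt).le)

/-- The plane minus the four slits. -/
def slitDomain (A B : ℝ) : Set ℂ :=
  ({w : ℂ | (w.im = A * Real.pi / 2 ∨ w.im = -(A * Real.pi / 2)) ∧ w.re ≤ -slitTip A B} ∪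
    {w : ℂ | (w.im = A * Real.pi / 2 ∨ w.im = -(A * Real.pi / 2)) ∧ slitTip A B ≤ w.re})ᶜ

lemma mem_slitDomain_iff {A B : ℝ} {w : ℂ} : w ∈ slitDomain A B ↔
    (w.im = A * Real.pi / 2 ∨ w.im = -(A * Real.pi / 2)) →
      -slitTip A B < w.re ∧ w.re < slitTip A B := by
  simp only [slitDomain, mem_compl_iff, mem_union, mem_ofPred_eq, ← not_le]
  tauto

lemma slitTip_pos {A B : ℝ} (hA : 0 < A) (hB : 0 < B) : 0 < slitTip A B := by
  obtain ⟨c₀, hc₀, hc2⟩ := exists_slitTip_parameter hA hB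
  rw [slitTip_eq hB hc₀ hc2]
  have h1 : 0 < c₀ - 1 := by linarith
  have : 0 ≤ Real.log ((c₀ + 1) / (c₀ - 1)) :=
    Real.log_nonneg ((one_le_div h1).2 (by linarith))
  positivity

lemma image_stripMap_subset {A B : ℝ} (hA : 0 < A) (hB : 0 < B) :
    stripMap A B '' {s | |s.re| < π / 2} ⊆ slitDomain A B := by
  rintro _ ⟨s, hs, rfl⟩
  rw [mem_slitDomain_iff]
  intro h
  refine ⟨?_, stripMap_re_lt_slitTip hA hB hs h⟩
  have hneg := stripMap_neg A B (le_of_lt hs) (complex_cos_ne_zero hs)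
  have := stripMap_re_lt_slitTip hA hB (s := -s) (by simpa using hs) (by
    rw [hneg, neg_im, neg_inj, neg_eq_iff_eq_neg]; exact h.symm)
  rw [hneg, neg_re] at this
  linarith

lemma isPreconnected_slitDomain {A B : ℝ} (hA : 0 < A) (hB : 0 < B) :
    IsPreconnected (slitDomain A B) := by
  have hx := slitTip_pos hA hB
  refine isPreconnected_of_forall 0 fun w hw => ?_
  have hline : IsPreconnected {z : ℂ | z.re = 0} :=
    (convex_hyperplane reLm.isLinear 0).isPreconnected
  have hseg : segment ℝ w (w.im * I) ⊆ slitDomain A B := by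
    rintro z ⟨a, b, ha, hb, hab, rfl⟩
    have him : (a • w + b • (w.im * I : ℂ)).im = w.im := by
      simp only [add_im, smul_im, mul_im, ofReal_re, I_im, ofReal_im, I_re, smul_eq_mul]
      linear_combination w.im * hab
    have hre : (a • w + b • (w.im * I : ℂ)).re = a * w.re := by simp
    rw [mem_slitDomain_iff, him, hre]
    intro h
    have h1 := (mem_slitDomain_iff.1 hw) h
    constructor <;> nlinarith
  refine ⟨segment ℝ w (w.im * I) ∪ {z : ℂ | z.re = 0}, union_subset hseg ?_, Or.inr rfl,
    Or.inl (left_mem_segment ℝ _ _),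
    (convex_segment w (w.im * I : ℂ)).isPreconnected.union (w.im * I)
      (right_mem_segment ℝ _ _) (by simp) hline⟩
  intro z hz
  rw [mem_slitDomain_iff]
  intro _
  rw [show z.re = 0 from hz]
  constructor <;> linarith

lemma image_stripMap {A B : ℝ} (hA : 0 < A) (hB : 0 < B) :
    stripMap A B '' {s | |s.re| < π / 2} = slitDomain A B := by
  refine (image_stripMap_subset hA hB).antisymm
    ((isPreconnected_slitDomain hA hB).subset_of_closure_inter_subset
      (isOpen_image_stripMap hA hB) ?_ ?_)
  · have h0 : (0 : ℂ) ∈ {s : ℂ | |s.re| < π / 2} := by simp [Real.pi_pos]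
    have := mem_image_of_mem (stripMap A B) h0
    exact ⟨_, image_stripMap_subset hA hB this, this⟩
  · rintro w ⟨hw, hmem⟩
    obtain ⟨s, hs, hcos, rfl⟩ := closure_image_stripMap hA hB hw
    rcases hs.lt_or_eq with h | h
    · exact ⟨s, h, rfl⟩
    exfalso
    rw [mem_slitDomain_iff] at hmem
    rcases (abs_eq Real.pi_div_two_pos.le).1 h with h | h
    · obtain ⟨h1, h2⟩ := stripMap_boundary hA hB h hcos
      exact (hmem h1).2.not_ge h2
    · obtain ⟨h1, h2⟩ := stripMap_boundary hA hB (s := -s) (by rw [neg_re, h, neg_neg])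
        (by rwa [Complex.cos_neg])
      rw [stripMap_neg A B hs hcos, neg_im, neg_inj, neg_eq_iff_eq_neg] at h1
      rw [stripMap_neg A B hs hcos, neg_re] at h2
      linarith [(hmem h1.symm).1]

lemma one_add_cos_ne_zero {s : ℂ} (hs : |s.re| < π / 2) : 1 + Complex.cos s ≠ 0 := by
  intro h
  have h1 := congrArg re h
  rw [add_re, cos_re_eq, one_re, zero_re] at h1
  have := mul_pos (cos_re_pos hs) (Real.cosh_pos s.im)
  linarith

/-- `s ↦ tan (s / 2)` maps the strip into the disk. -/
lemma sin_div_mem_unitDisk {s : ℂ} (hs : |s.re| < π / 2) :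
    Complex.sin s / (1 + Complex.cos s) ∈ unitDisk := by
  have h := one_add_cos_ne_zero hs
  rw [unitDisk, mem_ball_zero_iff, norm_div, div_lt_one (norm_pos_iff.2 h),
    ← sq_lt_sq₀ (norm_nonneg _) (norm_nonneg _), ← normSq_eq_norm_sq, ← normSq_eq_norm_sq,
    normSq_apply, normSq_apply, add_re, add_im, one_re, one_im, sin_re_eq, sin_im_eq, cos_re_eq,
    cos_im_eq]
  have hc := cos_re_pos hs
  have hy := Real.one_le_cosh s.im
  have h2 := Real.cosh_sq_sub_sinh_sq s.im
  have h3 := Real.sin_sq_add_cos_sq s.re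
  have h1 : 0 < 2 * Real.cos s.re * (Real.cosh s.im + Real.cos s.re) := by positivity
  have h4 : (1 + Real.cos s.re * Real.cosh s.im) * (1 + Real.cos s.re * Real.cosh s.im) +
      (0 + -(Real.sin s.re * Real.sinh s.im)) * (0 + -(Real.sin s.re * Real.sinh s.im)) -
      (Real.sin s.re * Real.cosh s.im * (Real.sin s.re * Real.cosh s.im) +
        Real.cos s.re * Real.sinh s.im * (Real.cos s.re * Real.sinh s.im)) =
      2 * Real.cos s.re * (Real.cosh s.im + Real.cos s.re) := by
    linear_combination (Real.cos s.re ^ 2 - Real.sin s.re ^ 2) * h2 - h3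
  linarith

lemma exists_sin_div_eq {z : ℂ} (hz : z ∈ unitDisk) :
    ∃ s : ℂ, |s.re| < π / 2 ∧ Complex.sin s / (1 + Complex.cos s) = z := by
  rw [unitDisk, mem_ball_zero_iff] at hz
  have hI : z ≠ I := fun h => by rw [h, norm_I] at hz; exact lt_irrefl _ hz
  have hI' : z ≠ -I := fun h => by rw [h, norm_neg, norm_I] at hz; exact lt_irrefl _ hz
  have hre : |(2 * Complex.arctan z).re| < π / 2 := by
    have h1 : (2 * Complex.arctan z).re = ((1 + z * I) / (1 - z * I)).arg := by
      rw [Complex.arctan, show 2 * (-I / 2 * Complex.log ((1 + z * I) / (1 - z * I))) =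
        -I * Complex.log ((1 + z * I) / (1 - z * I)) by ring]
      simp [log_im]
    rw [h1, abs_arg_lt_pi_div_two_iff]
    left
    have h2 : normSq z < 1 := by
      rw [normSq_eq_norm_sq]; nlinarith [norm_nonneg z]
    have h3 : 1 - z * I ≠ 0 := fun h => by
      have h4 : z * I = 1 := (sub_eq_zero.1 h).symm
      have := congrArg norm h4
      rw [norm_mul, norm_I, mul_one, norm_one] at this
      exact hz.ne this
    have h4 := normSq_pos.2 h3
    rw [div_re, ← add_div]
    refine div_pos ?_ h4
    rw [normSq_apply] at h2
    simp
    nlinarith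
  refine ⟨2 * Complex.arctan z, hre, ?_⟩
  have h1 := one_add_cos_ne_zero hre
  have h2 : Complex.cos (Complex.arctan z) ≠ 0 := fun h => by
    apply h1; rw [Complex.cos_two_mul, h]; ring
  conv_rhs => rw [← tan_arctan hI hI', Complex.tan_eq_sin_div_cos]
  rw [div_eq_div_iff h1 h2, Complex.sin_two_mul, Complex.cos_two_mul]
  ring

lemma phi_sin_div (A B : ℝ) {s : ℂ} (hs : |s.re| < π / 2) :
    (A : ℂ) * Complex.log ((1 + Complex.sin s / (1 + Complex.cos s)) /
        (1 - Complex.sin s / (1 + Complex.cos s))) +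
      (B : ℂ) * (Complex.sin s / (1 + Complex.cos s)) /
        (1 + (Complex.sin s / (1 + Complex.cos s)) ^ 2) = stripMap A B s := by
  have h := one_add_cos_ne_zero hs
  have hc := complex_cos_ne_zero hs
  have hsc := Complex.sin_sq_add_cos_sq s
  have hd : 1 + Complex.cos s - Complex.sin s ≠ 0 := by
    intro hd
    have : 2 * Complex.cos s * (1 + Complex.cos s) = 0 := by
      linear_combination (1 + Complex.cos s + Complex.sin s) * hd + hsc
    exact mul_ne_zero (mul_ne_zero two_ne_zero hc) h this
  have h1 : (1 + Complex.sin s / (1 + Complex.cos s)) /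
      (1 - Complex.sin s / (1 + Complex.cos s)) = (1 + Complex.sin s) / Complex.cos s := by
    rw [one_add_div h, one_sub_div h, div_div_div_cancel_right₀ h, div_eq_div_iff hd hc]
    linear_combination hsc
  have h2 : 1 + (Complex.sin s / (1 + Complex.cos s)) ^ 2 = 2 / (1 + Complex.cos s) := by
    field_simp
    linear_combination hsc
  rw [h1, h2, stripMap]
  congr 1
  field_simp

theorem slit_mapping_image_c_zero
    (A B : ℝ) (hA : 0 < A) (hB : 0 < B) :
    let φ : ℂ → ℂ := fun z =>
      (A : ℂ) * Complex.log ((1 + z) / (1 - z)) + (B : ℂ) * z / (1 + z ^ 2)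
    let x₀ : ℝ := A / 2 *
        Real.log ((Real.sqrt (2 * A + B) + Real.sqrt B) / (Real.sqrt (2 * A + B) - Real.sqrt B)) +
      Real.sqrt (B * (2 * A + B)) / 2
    Set.InjOn φ unitDisk ∧
    φ '' unitDisk =
      ({w : ℂ | (w.im = A * Real.pi / 2 ∨ w.im = -(A * Real.pi / 2)) ∧ w.re ≤ -x₀} ∪
       {w : ℂ | (w.im = A * Real.pi / 2 ∨ w.im = -(A * Real.pi / 2)) ∧ x₀ ≤ w.re})ᶜ := by
  intro φ x₀
  have hφ : ∀ s : ℂ, |s.re| < π / 2 →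
      φ (Complex.sin s / (1 + Complex.cos s)) = stripMap A B s := fun s hs => phi_sin_div A B hs
  constructor
  · intro z hz z' hz' h
    obtain ⟨s, hs, rfl⟩ := exists_sin_div_eq hz
    obtain ⟨s', hs', rfl⟩ := exists_sin_div_eq hz'
    rw [hφ s hs, hφ s' hs'] at h
    rw [stripMap_injOn hA hB hs hs' h]
  · refine Eq.trans ?_ (image_stripMap hA hB)
    ext w
    constructor
    · rintro ⟨z, hz, rfl⟩
      obtain ⟨s, hs, rfl⟩ := exists_sin_div_eq hz
      exact ⟨s, hs, (hφ s hs).symm⟩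
    · rintro ⟨s, hs, rfl⟩
      exact ⟨_, sin_div_mem_unitDisk hs, hφ s hs⟩
end
end
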